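/- arXiv:2108.02518 — 4 statements merged into one kernel-verified Lean document; each statement's English description precedes it below -/
import Mathlib

section
/- For all integers ℓ ≥ 3 and 2 ≤ k ≤ ℓ−1, the cone cA_ℓ^k over the (k,ℓ)-Shi-Ish arrangement is not supersolvable. -/
open scoped Classical
open Finset

noncomputable section

namespace Paper

variable {ι : Type}

/-- The intersection of a finite collection of subsets of `ι → ℝ`
(the empty intersection being the whole space). -/
def inter (B : Finset (Set (ι → ℝ))) : Set (ι → ℝ) := ⋂ H ∈ B, H

/-- The intersection poset `L(A)` of an arrangement `A`: all nonempty intersections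
of subcollections of `A` (including the whole space as the empty intersection),
ordered by reverse inclusion. -/
def L (A : Finset (Set (ι → ℝ))) : Finset (Set (ι → ℝ)) :=
  (A.powerset.image inter).filter fun X => X.Nonempty

/-- The dimension of a subset of `ι → ℝ` (as the dimension of the direction of
its affine span). -/
def dim (X : Set (ι → ℝ)) : ℕ := Module.finrank ℝ (affineSpan ℝ X).direction

/-- The elements of `L A` lying strictly above `X` in the intersection poset,
i.e. the sets `Y ∈ L A` with `Y ⊋ X`. -/
def above (A : Finset (Set (ι → ℝ))) (X : Set (ι → ℝ)) : Finset (Set (ι → ℝ)) :=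
  (L A).filter fun Y => X ⊂ Y

lemma above_lt {A : Finset (Set (ι → ℝ))} {X Y : Set (ι → ℝ)}
    (hY : Y ∈ above A X) : (above A Y).card < (above A X).card := by
  have hY' := Finset.mem_filter.mp hY
  apply Finset.card_lt_card
  rw [Finset.ssubset_iff_of_subset]
  · refine ⟨Y, hY, ?_⟩
    simp only [above, Finset.mem_filter, not_and]
    exact fun _ => ssubset_irrefl Y
  · intro Z hZ
    have hZ' := Finset.mem_filter.mp hZ
    exact Finset.mem_filter.mpr ⟨hZ'.1, hY'.2.trans hZ'.2⟩

/-- The Möbius function of the intersection poset: `μ(whole space) = 1`, and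
`μ(X) = - ∑_{Y ⊋ X} μ(Y)`. -/
def mob (A : Finset (Set (ι → ℝ))) (X : Set (ι → ℝ)) : ℤ :=
  if X = Set.univ then 1
  else - ∑ Y ∈ (above A X).attach, mob A Y.1
termination_by (above A X).card
decreasing_by exact above_lt Y.2

/-- The characteristic polynomial `χ_A(t) = ∑_{X ∈ L(A)} μ(X) t^{dim X}`. -/
def charPoly (A : Finset (Set (ι → ℝ))) : Polynomial ℤ :=
  ∑ X ∈ L A, Polynomial.C (mob A X) * Polynomial.X ^ dim X

/-- The localization `B_X = {H ∈ B : X ⊆ H}`. -/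
def loc (B : Finset (Set (ι → ℝ))) (X : Set (ι → ℝ)) : Finset (Set (ι → ℝ)) :=
  B.filter fun H => X ⊆ H

open Pointwise in
/-- `X` is a modular element of `L(B)`: `X ∈ L(B)` and `X + Y ∈ L(B)` for all `Y ∈ L(B)`. -/
def IsModular (B : Finset (Set (ι → ℝ))) (X : Set (ι → ℝ)) : Prop :=
  X ∈ L B ∧ ∀ Y ∈ L B, X + Y ∈ L B

/-- The rank of an arrangement: maximal codimension of an element of `L(B)`. -/
def rank [Fintype ι] (B : Finset (Set (ι → ℝ))) : ℕ :=
  (L B).sup fun X => Fintype.card ι - dim X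

/-- A modular coatom: a modular element of codimension `rank B - 1`. -/
def IsModularCoatom [Fintype ι] (B : Finset (Set (ι → ℝ))) (X : Set (ι → ℝ)) : Prop :=
  IsModular B X ∧ Fintype.card ι - dim X = rank B - 1

/-- A central arrangement is supersolvable if there is a chain of localizations
`∅ = B_{X_0} ⊆ B_{X_1} ⊆ ⋯ ⊆ B_{X_r} = B` (`r = rank B`) in which each `X_i` is a
modular coatom of `B_{X_{i+1}}`. -/
def IsSupersolvable [Fintype ι] (B : Finset (Set (ι → ℝ))) : Prop :=
  ∃ X : Fin (rank B + 1) → Set (ι → ℝ),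
    loc B (X 0) = ∅ ∧ loc B (X (Fin.last (rank B))) = B ∧
    (∀ i j : Fin (rank B + 1), i ≤ j → loc B (X i) ⊆ loc B (X j)) ∧
    ∀ i : Fin (rank B), IsModularCoatom (loc B (X i.succ)) (X i.castSucc)

/-- The polynomial ring `S = ℝ[x_i : i ∈ ι]`. -/
abbrev S (ι : Type) := MvPolynomial ι ℝ

/-- Derivations of `S` over `ℝ`. -/
abbrev Der (ι : Type) := Derivation ℝ (S ι) (S ι)

/-- The linear polynomial `∑ c_i x_i`. -/
def linPoly [Fintype ι] (c : ι → ℝ) : S ι := ∑ i, MvPolynomial.C (c i) * MvPolynomial.X i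

/-- The linear hyperplane `{x : ∑ c_i x_i = 0}`. -/
def linHyp [Fintype ι] (c : ι → ℝ) : Set (ι → ℝ) := {x | ∑ i, c i * x i = 0}

/-- `θ` is a logarithmic derivation of the central arrangement `B`:
`θ(α_H) ∈ α_H S` for every defining linear form `α_H` of every `H ∈ B`. -/
def IsLogDer [Fintype ι] (B : Finset (Set (ι → ℝ))) (θ : Der ι) : Prop :=
  ∀ c : ι → ℝ, c ≠ 0 → linHyp c ∈ B → linPoly c ∣ θ (linPoly c)

/-- A derivation `θ = ∑ f_j ∂/∂x_j` is homogeneous of degree `d` if every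
coefficient `f_j = θ(x_j)` is homogeneous of degree `d`. -/
def IsHomog (θ : Der ι) (d : ℕ) : Prop :=
  ∀ j : ι, MvPolynomial.IsHomogeneous (θ (MvPolynomial.X j)) d

/-- `B` is free with exponents `d`: `D(B)` is a free `S`-module with a homogeneous
basis `θ_i`, `i ∈ ι`, of degrees `d_i`. -/
def IsFreeWith [Fintype ι] (B : Finset (Set (ι → ℝ))) (d : ι → ℕ) : Prop :=
  ∃ θ : ι → Der ι,
    (∀ i, IsLogDer B (θ i)) ∧ (∀ i, IsHomog (θ i) (d i)) ∧
    ∀ η : Der ι, IsLogDer B η → ∃! f : ι → S ι, η = ∑ i, f i • θ i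

/-- `B` is a free arrangement. -/
def IsFree [Fintype ι] (B : Finset (Set (ι → ℝ))) : Prop := ∃ d : ι → ℕ, IsFreeWith B d

/-- Logarithmic derivation of a multiarrangement `(B, mult)`:
`θ(α_H) ∈ α_H^{mult H} S` for every `H ∈ B`. -/
def IsLogDerMulti [Fintype ι] (B : Finset (Set (ι → ℝ))) (mult : Set (ι → ℝ) → ℕ)
    (θ : Der ι) : Prop :=
  ∀ c : ι → ℝ, c ≠ 0 → linHyp c ∈ B → linPoly c ^ mult (linHyp c) ∣ θ (linPoly c)

/-- Freeness of the multiarrangement `(B, mult)`: `D(B, mult)` is a free `S`-module. -/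
def IsFreeMulti [Fintype ι] (B : Finset (Set (ι → ℝ))) (mult : Set (ι → ℝ) → ℕ) : Prop :=
  ∃ θ : ι → Der ι,
    (∀ i, IsLogDerMulti B mult (θ i)) ∧
    ∀ η : Der ι, IsLogDerMulti B mult η → ∃! f : ι → S ι, η = ∑ i, f i • θ i

/-- `B` is locally free in codimension three along the hyperplane `H`:
every localization at an `X ∈ L(B)` with `X ⊆ H` of codimension 3 is free. -/
def LocallyFree3 [Fintype ι] (B : Finset (Set (ι → ℝ))) (H : Set (ι → ℝ)) : Prop :=
  ∀ X ∈ L B, X ⊆ H → Fintype.card ι - dim X = 3 → IsFree (loc B X)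

/-- The ψ-digraphical arrangement `A(G, ψ)` of the digraph with edge set `E` on the
vertex set `ι` and weight `ψ(i) = [a i, b i]`:  hyperplanes `x_i - x_j = 0` for all
distinct `i, j`, `x_i - x_j = 1` for `(i,j) ∈ E`, and `x_i = c` for `c ∈ [a i, b i]`. -/
def digArr [Fintype ι] (E : Finset (ι × ι)) (a b : ι → ℤ) : Finset (Set (ι → ℝ)) :=
  ((univ.filter fun p : ι × ι => p.1 ≠ p.2).image fun p =>
      {x : ι → ℝ | x p.1 - x p.2 = 0})
  ∪ (E.image fun p => {x : ι → ℝ | x p.1 - x p.2 = 1})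
  ∪ (univ.biUnion fun i : ι =>
      (Finset.Icc (a i) (b i)).image fun c => {x : ι → ℝ | x i = (c : ℝ)})

/-- The cone `cA(G, ψ)` over the ψ-digraphical arrangement, a central arrangement in
`ℝ^{ℓ+1}` with coordinates indexed by `Option ι` (the coordinate `z` being `x none`). -/
def coneDigArr [Fintype ι] (E : Finset (ι × ι)) (a b : ι → ℤ) :
    Finset (Set (Option ι → ℝ)) :=
  ({({x : Option ι → ℝ | x none = 0})} : Finset (Set (Option ι → ℝ)))
  ∪ ((univ.filter fun p : ι × ι => p.1 ≠ p.2).image fun p =>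
      {x : Option ι → ℝ | x (some p.1) - x (some p.2) = 0})
  ∪ (E.image fun p => {x : Option ι → ℝ | x (some p.1) - x (some p.2) = x none})
  ∪ (univ.biUnion fun i : ι =>
      (Finset.Icc (a i) (b i)).image fun c =>
        {x : Option ι → ℝ | x (some i) = (c : ℝ) * x none})

/-- The restriction of the edge set `E` to the vertex set `ι ∖ {v}`. -/
def Eres (E : Finset (ι × ι)) (v : ι) :
    Finset ({i : ι // i ≠ v} × {i : ι // i ≠ v}) :=
  ((E.filter fun e => e.1 ≠ v ∧ e.2 ≠ v).attach).image fun e =>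
    (⟨e.1.1, (Finset.mem_filter.mp e.2).2.1⟩, ⟨e.1.2, (Finset.mem_filter.mp e.2).2.2⟩)

/-- The element `X_v ∈ L(cA(G,ψ))`: the intersection of `z = 0`, `x_i - x_j = 0`
(`i, j ≠ v`), `x_i - x_j = z` (edges `(i,j)` with `i, j ≠ v`) and `x_i = cz`
(`i ≠ v`, `c ∈ ψ(i)`). -/
def Xv (E : Finset (ι × ι)) (a b : ι → ℤ) (v : ι) : Set (Option ι → ℝ) :=
  {x | x none = 0 ∧
    (∀ i j : ι, i ≠ v → j ≠ v → x (some i) - x (some j) = 0) ∧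
    (∀ p ∈ E, p.1 ≠ v → p.2 ≠ v → x (some p.1) - x (some p.2) = x none) ∧
    (∀ i : ι, i ≠ v → ∀ c ∈ Finset.Icc (a i) (b i), x (some i) = (c : ℝ) * x none)}

/-- `v` is a simplicial vertex of `(G, ψ)`: `X_v` is a modular coatom of `cA(G,ψ)`. -/
def Simplicial [Fintype ι] (E : Finset (ι × ι)) (a b : ι → ℤ) (v : ι) : Prop :=
  IsModularCoatom (coneDigArr E a b) (Xv E a b v)

/-- Restriction of a subset of the cone space to the infinite hyperplane `z = 0`,
identified with `ι → ℝ`. -/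
def resH (K : Set (Option ι → ℝ)) : Set (ι → ℝ) :=
  {y | (fun o : Option ι => Option.elim o 0 y) ∈ K}

/-- Embedding of a subset of the infinite hyperplane back into the cone space. -/
def embedH (Y : Set (ι → ℝ)) : Set (Option ι → ℝ) :=
  {x | x none = 0 ∧ (fun i : ι => x (some i)) ∈ Y}

/-- The underlying arrangement of the Ziegler restriction of `B` onto the infinite
hyperplane `z = 0`. -/
def zieglerArr (B : Finset (Set (Option ι → ℝ))) : Finset (Set (ι → ℝ)) :=
  (B.erase {x | x none = 0}).image resH

/-- The Ziegler multiplicity `m^{H_∞}(X) = |{K ∈ B : X ⊆ K}| - 1`. -/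
def zieglerMult (B : Finset (Set (Option ι → ℝ))) (Y : Set (ι → ℝ)) : ℕ :=
  (B.filter fun K => embedH Y ⊆ K).card - 1

/-- The (k,ℓ)-Shi-Ish arrangement in `ℝ^ℓ` (0-based vertices `0,…,ℓ-1` standing
for the labels `1,…,ℓ`). -/
def ShiIsh (ℓ k : ℕ) : Finset (Set (Fin ℓ → ℝ)) :=
  ((univ.filter fun p : Fin ℓ × Fin ℓ => p.1 < p.2).image fun p =>
      {x : Fin ℓ → ℝ | x p.1 - x p.2 = 0})
  ∪ ((univ.filter fun p : Fin ℓ × Fin ℓ => p.1 < p.2 ∧ k ≤ (p.1 : ℕ) + 1).image fun p =>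
      {x : Fin ℓ → ℝ | x p.1 - x p.2 = 1})
  ∪ ((univ.filter fun p : Fin ℓ × Fin ℓ => (p.1 : ℕ) = 0).biUnion fun p =>
      ((Finset.Icc 1 ((p.2 : ℕ))).filter fun c => c < k).image fun c =>
        {x : Fin ℓ → ℝ | x p.1 - x p.2 = (c : ℝ)})

/-- The cone over the (k,ℓ)-Shi-Ish arrangement, a central arrangement in `ℝ^{ℓ+1}`
with coordinates indexed by `Option (Fin ℓ)` (the coordinate `z` being `x none`). -/
def cShiIsh (ℓ k : ℕ) : Finset (Set (Option (Fin ℓ) → ℝ)) :=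
  ({({x : Option (Fin ℓ) → ℝ | x none = 0})} : Finset (Set (Option (Fin ℓ) → ℝ)))
  ∪ ((univ.filter fun p : Fin ℓ × Fin ℓ => p.1 < p.2).image fun p =>
      {x : Option (Fin ℓ) → ℝ | x (some p.1) - x (some p.2) = 0})
  ∪ ((univ.filter fun p : Fin ℓ × Fin ℓ => p.1 < p.2 ∧ k ≤ (p.1 : ℕ) + 1).image fun p =>
      {x : Option (Fin ℓ) → ℝ | x (some p.1) - x (some p.2) = x none})
  ∪ ((univ.filter fun p : Fin ℓ × Fin ℓ => (p.1 : ℕ) = 0).biUnion fun p =>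
      ((Finset.Icc 1 ((p.2 : ℕ))).filter fun c => c < k).image fun c =>
        {x : Option (Fin ℓ) → ℝ | x (some p.1) - x (some p.2) = (c : ℝ) * x none})

/-- The digraph `T_ℓ^k` on `ℓ` 0-based vertices, with edges `(i,j)` for `i < j`
with label `(j : ℕ) + 1 ≤ ℓ - k + 1`. -/
def Tlk (ℓ k : ℕ) : Finset (Fin ℓ × Fin ℓ) :=
  univ.filter fun p : Fin ℓ × Fin ℓ => p.1 < p.2 ∧ (p.2 : ℕ) + 1 ≤ ℓ - k + 1

/-- The lower endpoint of the weight `ψ_ℓ^k(i) = [-min(ℓ-i+1, k), 0]`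
(0-based vertex `i` standing for the label `i+1`, so `ℓ - label + 1 = ℓ - i`). -/
def psiLk (ℓ k : ℕ) (i : Fin ℓ) : ℤ := -(min (ℓ - (i : ℕ)) k : ℤ)

end Paper

namespace Paper

section Modular

lemma exists_submodule_inter {B : Finset (Set (ι → ℝ))}
    (hB : ∀ H ∈ B, ∃ W : Submodule ℝ (ι → ℝ), (W : Set (ι → ℝ)) = H) :
    ∃ W : Submodule ℝ (ι → ℝ), (W : Set (ι → ℝ)) = inter B := by
  choose! W hW using hB
  refine ⟨⨅ H ∈ B, W H, ?_⟩
  ext x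
  simp only [Submodule.coe_iInf, inter, Set.mem_iInter]
  exact forall₂_congr fun H hH => by rw [hW H hH]

lemma exists_submodule_of_mem_L {B : Finset (Set (ι → ℝ))} {X : Set (ι → ℝ)}
    (hB : ∀ H ∈ B, ∃ W : Submodule ℝ (ι → ℝ), (W : Set (ι → ℝ)) = H) (hX : X ∈ L B) :
    ∃ W : Submodule ℝ (ι → ℝ), (W : Set (ι → ℝ)) = X := by
  obtain ⟨hX, -⟩ := Finset.mem_filter.mp hX
  obtain ⟨C, hC, rfl⟩ := Finset.mem_image.mp hX
  exact exists_submodule_inter fun H hH => hB H (Finset.mem_powerset.mp hC hH)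

lemma mem_L_of_subset {B C : Finset (Set (ι → ℝ))}
    (hC : C ⊆ B) (h : (inter C).Nonempty) : inter C ∈ L B :=
  Finset.mem_filter.mpr
    ⟨Finset.mem_image_of_mem _ (Finset.mem_powerset.mpr hC), h⟩

lemma dim_coe_submodule (W : Submodule ℝ (ι → ℝ)) :
    dim (W : Set (ι → ℝ)) = Module.finrank ℝ W := by
  have h := affineSpan_insert_zero (k := ℝ) (W : Set (ι → ℝ))
  rw [Set.insert_eq_of_mem W.zero_mem, Submodule.span_eq] at h
  have h' : affineSpan ℝ (W : Set (ι → ℝ)) = W.toAffineSubspace := SetLike.coe_injective h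
  rw [dim, h', Submodule.toAffineSubspace_direction]

variable [Fintype ι]

lemma codim_le_rank {B : Finset (Set (ι → ℝ))} {X : Set (ι → ℝ)} (hX : X ∈ L B) :
    Fintype.card ι - dim X ≤ rank B :=
  Finset.le_sup (f := fun X => Fintype.card ι - dim X) hX

/-- If `H₁` does not contain the modular coatom `X`, then `H₁` meets every other hyperplane
inside a hyperplane of the arrangement that contains `X`. -/
lemma IsModularCoatom.exists_inter_subset {B : Finset (Set (ι → ℝ))} {X : Set (ι → ℝ)}
    (hB : ∀ H ∈ B, ∃ W : Submodule ℝ (ι → ℝ), (W : Set (ι → ℝ)) = H)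
    (hX : IsModularCoatom B X) {H₁ H₂ : Set (ι → ℝ)} (h₁ : H₁ ∈ B) (h₂ : H₂ ∈ B)
    (hX₁ : ¬ X ⊆ H₁) (h₁₂ : ¬ H₁ ⊆ H₂) :
    ∃ H₃ ∈ B, X ⊆ H₃ ∧ H₁ ∩ H₂ ⊆ H₃ := by
  obtain ⟨⟨hXL, hmod⟩, hrank⟩ := hX
  obtain ⟨V, rfl⟩ := exists_submodule_of_mem_L hB hXL
  obtain ⟨W₁, rfl⟩ := hB _ h₁
  obtain ⟨W₂, rfl⟩ := hB _ h₂
  have hpair : inter {(W₁ : Set (ι → ℝ)), (W₂ : Set (ι → ℝ))} =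
      ((W₁ ⊓ W₂ : Submodule ℝ (ι → ℝ)) : Set (ι → ℝ)) := by
    simp [inter]
  have hpairL : ((W₁ ⊓ W₂ : Submodule ℝ (ι → ℝ)) : Set (ι → ℝ)) ∈ L B := by
    rw [← hpair]
    refine mem_L_of_subset ?_ (by rw [hpair]; exact ⟨0, zero_mem _⟩)
    simp [Finset.insert_subset_iff, h₁, h₂]
  have hsum := hmod _ hpairL
  rw [← Submodule.coe_sup] at hsum
  obtain ⟨hsum, -⟩ := Finset.mem_filter.mp hsum
  obtain ⟨C, hC, hCsum⟩ := Finset.mem_image.mp hsum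
  rw [Finset.mem_powerset] at hC
  obtain rfl | ⟨H₃, hH₃⟩ := C.eq_empty_or_nonempty
  · exfalso
    have htop : V ⊔ (W₁ ⊓ W₂) = ⊤ := by
      rw [← SetLike.coe_set_eq, ← hCsum]
      simp [inter]
    obtain ⟨hVi, -⟩ := Finset.mem_filter.mp hXL
    obtain ⟨D, hD, hDV⟩ := Finset.mem_image.mp hVi
    rw [Finset.mem_powerset] at hD
    have hmeet : inter (D ∪ {(W₁ : Set (ι → ℝ)), (W₂ : Set (ι → ℝ))}) =
        ((V ⊓ (W₁ ⊓ W₂) : Submodule ℝ (ι → ℝ)) : Set (ι → ℝ)) := by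
      rw [Submodule.coe_inf, ← hDV, ← hpair]
      simp only [inter]
      ext x
      simp only [Finset.mem_union, Set.mem_iInter, Set.mem_inter_iff, or_imp, forall_and]
    have hmeetL : ((V ⊓ (W₁ ⊓ W₂) : Submodule ℝ (ι → ℝ)) : Set (ι → ℝ)) ∈ L B := by
      rw [← hmeet]
      refine mem_L_of_subset ?_ (by rw [hmeet]; exact ⟨0, zero_mem _⟩)
      refine Finset.union_subset hD ?_
      simp [Finset.insert_subset_iff, h₁, h₂]
    have hle := codim_le_rank hmeetL
    rw [dim_coe_submodule] at hle hrank
    have hdim := Submodule.finrank_sup_add_finrank_inf_eq V (W₁ ⊓ W₂)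
    rw [htop, finrank_top, Module.finrank_fintype_fun_eq_card] at hdim
    have hV := Submodule.finrank_le V
    rw [Module.finrank_fintype_fun_eq_card] at hV
    have hlt₁ : Module.finrank ℝ W₁ < Fintype.card ι := by
      rw [← Module.finrank_fintype_fun_eq_card ℝ]
      refine Submodule.finrank_lt fun h => hX₁ ?_
      simp [h]
    have hlt₂ : Module.finrank ℝ (W₁ ⊓ W₂ : Submodule ℝ (ι → ℝ)) < Module.finrank ℝ W₁ :=
      Submodule.finrank_lt_finrank_of_lt
        (inf_lt_left.mpr fun h => h₁₂ (SetLike.coe_subset_coe.mpr h))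
    omega
  · have hsub : (V ⊔ (W₁ ⊓ W₂) : Submodule ℝ (ι → ℝ)) ≤ (H₃ : Set (ι → ℝ)) := by
      rw [← hCsum]
      exact Set.biInter_subset_of_mem hH₃
    refine ⟨H₃, hC hH₃, ?_, ?_⟩
    · exact (SetLike.coe_subset_coe.mpr le_sup_left).trans hsub
    · rw [← Submodule.coe_inf]
      exact (SetLike.coe_subset_coe.mpr le_sup_right).trans hsub

/-- If `B` is supersolvable and `B_Y` is nonempty, some subspace `V`, not contained in all
hyperplanes of `B_Y`, has the property of `IsModularCoatom.exists_inter_subset` for `B_Y`. -/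
lemma IsSupersolvable.exists_submodule_of_loc {B : Finset (Set (ι → ℝ))}
    (hB : ∀ H ∈ B, ∃ W : Submodule ℝ (ι → ℝ), (W : Set (ι → ℝ)) = H)
    (hs : IsSupersolvable B) (Y : Set (ι → ℝ)) (hY : (loc B Y).Nonempty) :
    ∃ V : Submodule ℝ (ι → ℝ), (∃ H ∈ loc B Y, ¬ (V : Set (ι → ℝ)) ⊆ H) ∧
      ∀ H₁ ∈ loc B Y, ∀ H₂ ∈ loc B Y, ¬ (V : Set (ι → ℝ)) ⊆ H₁ → ¬ H₁ ⊆ H₂ →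
        ∃ H₃ ∈ loc B Y, (V : Set (ι → ℝ)) ⊆ H₃ ∧ H₁ ∩ H₂ ⊆ H₃ := by
  obtain ⟨X, h0, hlast, -, hcoatom⟩ := hs
  obtain ⟨i, hi, hi'⟩ : ∃ i : Fin (rank B), ¬ loc B Y ⊆ loc B (X i.castSucc) ∧
      loc B Y ⊆ loc B (X i.succ) := by
    by_contra! h
    have hnot : ∀ i, ¬ loc B Y ⊆ loc B (X i) := by
      intro i
      induction i using Fin.induction with
      | zero =>
        rw [h0, Finset.subset_empty]
        exact hY.ne_empty
      | succ i ih => exact h i ih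
    refine hnot (Fin.last _) ?_
    rw [hlast]
    exact Finset.filter_subset _ _
  have hBi : ∀ H ∈ loc B (X i.succ), ∃ W : Submodule ℝ (ι → ℝ), (W : Set (ι → ℝ)) = H :=
    fun H hH => hB H (Finset.mem_filter.mp hH).1
  obtain ⟨V, hV⟩ := exists_submodule_of_mem_L hBi (hcoatom i).1.1
  refine ⟨V, ?_, fun H₁ h₁ H₂ h₂ hX₁ h₁₂ => ?_⟩
  · obtain ⟨H, hH, hH'⟩ := Finset.not_subset.mp hi
    refine ⟨H, hH, fun h => hH' (Finset.mem_filter.mpr ⟨(Finset.mem_filter.mp hH).1, ?_⟩)⟩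
    rwa [← hV]
  · rw [hV] at hX₁ ⊢
    obtain ⟨H₃, h₃, hX₃, hsub⟩ :=
      (hcoatom i).exists_inter_subset hBi (hi' h₁) (hi' h₂) hX₁ h₁₂
    refine ⟨H₃, Finset.mem_filter.mpr ⟨(Finset.mem_filter.mp h₃).1, ?_⟩, hX₃, hsub⟩
    exact (Set.subset_inter (Finset.mem_filter.mp h₁).2 (Finset.mem_filter.mp h₂).2).trans hsub

end Modular

section Grid

variable {E : Type*} [AddCommGroup E] [Module ℝ E]

/-- The cone over the affine line arrangement `a = c`, `b = c` (`0 ≤ c < k`), `b - a = 0`,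
`b - a = 1`, where `z` is the homogenizing coordinate. -/
def gridCone (a b z : E →ₗ[ℝ] ℝ) (k : ℕ) : Set (Set E) :=
  {H | H = {x | z x = 0} ∨ (∃ c : ℕ, c < k ∧ H = {x | a x = c * z x}) ∨
    (∃ c : ℕ, c < k ∧ H = {x | b x = c * z x}) ∨
    H = {x | b x - a x = 0} ∨ H = {x | b x - a x = z x}}

/-- The arrangement `gridCone` admits no subspace with the property of modular coatoms
of `IsModularCoatom.exists_inter_subset`. -/
lemma gridCone_not_modular {a b z : E →ₗ[ℝ] ℝ} {k : ℕ} (hk : 2 ≤ k)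
    (hsurj : ∀ p q r : ℝ, ∃ x, a x = p ∧ b x = q ∧ z x = r) (V : Submodule ℝ E)
    (hV : ∃ H ∈ gridCone a b z k, ¬ (V : Set E) ⊆ H)
    (hmod : ∀ H₁ ∈ gridCone a b z k, ∀ H₂ ∈ gridCone a b z k, ¬ (V : Set E) ⊆ H₁ →
      ¬ H₁ ⊆ H₂ → ∃ H₃ ∈ gridCone a b z k, (V : Set E) ⊆ H₃ ∧ H₁ ∩ H₂ ⊆ H₃) :
    False := by
  have hA : ∀ c : ℕ, c < k → {x | a x = c * z x} ∈ gridCone a b z k :=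
    fun c hc => .inr <| .inl ⟨c, hc, rfl⟩
  have hB : ∀ c : ℕ, c < k → {x | b x = c * z x} ∈ gridCone a b z k :=
    fun c hc => .inr <| .inr <| .inl ⟨c, hc, rfl⟩
  have hZ : {x | z x = 0} ∈ gridCone a b z k := .inl rfl
  have hD : {x | b x - a x = z x} ∈ gridCone a b z k := .inr <| .inr <| .inr <| .inr rfl
  have hD₀ : {x | b x - a x = 0} ∈ gridCone a b z k := .inr <| .inr <| .inr <| .inl rfl
  have hk' : (2 : ℝ) ≤ k := by exact_mod_cast hk
  have hcast : ((k - 1 : ℕ) : ℝ) = k - 1 := by push_cast [show 1 ≤ k by omega]; ring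
  have hk₁ : k - 1 < k := by omega
  obtain ⟨u, hua, hub, huz⟩ := hsurj (k - 1) 0 1
  obtain ⟨v, hva, hvb, hvz⟩ := hsurj (-1) 0 1
  obtain ⟨w, hwa, hwb, hwz⟩ := hsurj (k - 1) k 1
  obtain ⟨e, hea, heb, hez⟩ := hsurj 1 0 0
  obtain ⟨f, hfa, hfb, hfz⟩ := hsurj 0 1 0
  obtain ⟨g, hga, hgb, hgz⟩ := hsurj 1 1 0
  have key : ∀ x y : E, ∀ H₁ ∈ gridCone a b z k, ∀ H₂ ∈ gridCone a b z k,
      x ∈ H₁ → x ∈ H₂ → y ∈ H₁ → y ∉ H₂ →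
      (V : Set E) ⊆ H₁ ∨ ∃ H₃ ∈ gridCone a b z k, (V : Set E) ⊆ H₃ ∧ x ∈ H₃ := by
    intro x y H₁ h₁ H₂ h₂ hx₁ hx₂ hy₁ hy₂
    refine or_iff_not_imp_left.mpr fun hV₁ => ?_
    obtain ⟨H₃, h₃, hV₃, hsub⟩ := hmod H₁ h₁ H₂ h₂ hV₁ fun h => hy₂ (h hy₁)
    exact ⟨H₃, h₃, hV₃, hsub ⟨hx₁, hx₂⟩⟩
  have hu : (∀ x ∈ V, a x = (k - 1) * z x) ∨ (∀ x ∈ V, b x = 0) := by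
    obtain h | ⟨_, rfl | ⟨c, hc, rfl⟩ | ⟨c, hc, rfl⟩ | rfl | rfl, hV₃, hx⟩ :=
      key u w _ (hA (k - 1) hk₁) _ (hB 0 (by omega)) (by simp [*]) (by simp [*])
        (by simp [*]) (by simp [*]; linarith)
    · exact .inl fun x hx => by rw [← hcast]; exact h hx
    all_goals simp only [Set.mem_ofPred_eq, hua, hub, huz, mul_one] at hx
    · linarith
    · exact .inl fun x hx' => by rw [hx]; exact hV₃ hx'
    · exact .inr fun x hx' => by simpa [← hx] using hV₃ hx'
    · linarith
    · linarith
  have hv : (∀ x ∈ V, b x = 0) ∨ (∀ x ∈ V, b x - a x = z x) := by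
    obtain h | ⟨_, rfl | ⟨c, hc, rfl⟩ | ⟨c, hc, rfl⟩ | rfl | rfl, hV₃, hx⟩ :=
      key v u _ (hB 0 (by omega)) _ hD (by simp [*]) (by simp [*])
        (by simp [*]) (by simp [*]; linarith)
    · exact .inl fun x hx => by simpa using h hx
    all_goals simp only [Set.mem_ofPred_eq, hva, hvb, hvz, mul_one] at hx
    · linarith
    · linarith [c.cast_nonneg (α := ℝ)]
    · exact .inl fun x hx' => by simpa [← hx] using hV₃ hx'
    · linarith
    · exact .inr hV₃
  have hw : (∀ x ∈ V, a x = (k - 1) * z x) ∨ (∀ x ∈ V, b x - a x = z x) := by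
    obtain h | ⟨_, rfl | ⟨c, hc, rfl⟩ | ⟨c, hc, rfl⟩ | rfl | rfl, hV₃, hx⟩ :=
      key w u _ (hA (k - 1) hk₁) _ hD (by simp [*]) (by simp [*])
        (by simp [*]) (by simp [*]; linarith)
    · exact .inl fun x hx => by rw [← hcast]; exact h hx
    all_goals simp only [Set.mem_ofPred_eq, hwa, hwb, hwz, mul_one] at hx
    · linarith
    · exact .inl fun x hx' => by rw [hx]; exact hV₃ hx'
    · exact absurd (Nat.cast_injective hx) hc.ne'
    · linarith
    · exact .inr hV₃
  have hf : (∀ x ∈ V, z x = 0) ∨ ∃ c : ℕ, c < k ∧ ∀ x ∈ V, a x = c * z x := by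
    obtain h | ⟨_, rfl | ⟨c, hc, rfl⟩ | ⟨c, hc, rfl⟩ | rfl | rfl, hV₃, hx⟩ :=
      key f e _ hZ _ (hA 0 (by omega)) (by simp [*]) (by simp [*]) (by simp [*]) (by simp [*])
    · exact .inl h
    all_goals simp only [Set.mem_ofPred_eq, hfa, hfb, hfz] at hx
    · exact .inl hV₃
    · exact .inr ⟨c, hc, hV₃⟩
    all_goals linarith
  have he : (∀ x ∈ V, z x = 0) ∨ ∃ c : ℕ, c < k ∧ ∀ x ∈ V, b x = c * z x := by
    obtain h | ⟨_, rfl | ⟨c, hc, rfl⟩ | ⟨c, hc, rfl⟩ | rfl | rfl, hV₃, hx⟩ :=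
      key e f _ hZ _ (hB 0 (by omega)) (by simp [*]) (by simp [*]) (by simp [*]) (by simp [*])
    · exact .inl h
    all_goals simp only [Set.mem_ofPred_eq, hea, heb, hez] at hx
    · exact .inl hV₃
    · linarith
    · exact .inr ⟨c, hc, hV₃⟩
    all_goals linarith
  have hg : (∀ x ∈ V, z x = 0) ∨ (∀ x ∈ V, b x - a x = 0) ∨ (∀ x ∈ V, b x - a x = z x) := by
    obtain h | ⟨_, rfl | ⟨c, hc, rfl⟩ | ⟨c, hc, rfl⟩ | rfl | rfl, hV₃, hx⟩ :=
      key g e _ hZ _ hD₀ (by simp [*]) (by simp [*]) (by simp [*]) (by simp [*])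
    · exact .inl h
    all_goals simp only [Set.mem_ofPred_eq, hga, hgb, hgz] at hx
    · exact .inl hV₃
    · linarith
    · linarith
    · exact .inr (.inl hV₃)
    · exact .inr (.inr hV₃)
  by_cases hz : ∀ x ∈ V, z x = 0
  · have hab : ∀ x ∈ V, a x = 0 ∧ b x = 0 := by
      intro x hx
      have := hz x hx
      rcases hu with hu | hu <;> rcases hv with hv | hv <;> rcases hw with hw | hw <;>
        have h₁ := hu x hx <;> have h₂ := hv x hx <;> have h₃ := hw x hx <;>
        simp only [this, mul_zero] at h₁ h₂ h₃ <;> constructor <;> linarith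
    obtain ⟨H, rfl | ⟨c, hc, rfl⟩ | ⟨c, hc, rfl⟩ | rfl | rfl, hH⟩ := hV
    all_goals exact hH fun x hx => by simp [hab x hx, hz x hx]
  · push Not at hz
    obtain ⟨x, hx, hzx⟩ := hz
    have hz' : ¬ ∀ x ∈ V, z x = 0 := fun h => hzx (h x hx)
    obtain ⟨c, hc, hac⟩ := hf.resolve_left hz'
    obtain ⟨d, hd, hbd⟩ := he.resolve_left hz'
    replace hg := hg.resolve_left hz'
    replace hac := hac x hx
    replace hbd := hbd x hx
    have hc₀ : (0 : ℝ) ≤ c := c.cast_nonneg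
    have hdk : (d : ℝ) < k := Nat.cast_lt.mpr hd
    have hvanish : ∀ r : ℝ, r * z x = 0 → r = 0 :=
      fun r hr => (mul_eq_zero.mp hr).resolve_right hzx
    rcases hu with hu | hu
    · rcases hv with hv | hv
      · rcases hg with hg | hg
        · linarith [hvanish (k - 1) (by linarith [hu x hx, hv x hx, hg x hx])]
        · linarith [hvanish k (by linarith [hu x hx, hv x hx, hg x hx])]
      · linarith [hvanish (k - d) (by linarith [hu x hx, hv x hx])]
    · rcases hw with hw | hw
      · rcases hg with hg | hg
        · linarith [hvanish (k - 1) (by linarith [hu x hx, hw x hx, hg x hx])]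
        · linarith [hvanish k (by linarith [hu x hx, hw x hx, hg x hx])]
      · linarith [hvanish (c + 1) (by linarith [hu x hx, hw x hx])]

end Grid

lemma exists_submodule_of_mem_cShiIsh {ℓ k : ℕ} :
    ∀ H ∈ cShiIsh ℓ k, ∃ W : Submodule ℝ (Option (Fin ℓ) → ℝ), (W : Set _) = H := by
  have hker : ∀ φ : (Option (Fin ℓ) → ℝ) →ₗ[ℝ] ℝ,
      ∃ W : Submodule ℝ (Option (Fin ℓ) → ℝ), (W : Set _) = {x | φ x = 0} :=
    fun φ => ⟨LinearMap.ker φ, by ext; simp⟩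
  let π (o : Option (Fin ℓ)) : (Option (Fin ℓ) → ℝ) →ₗ[ℝ] ℝ := LinearMap.proj o
  intro H hH
  simp only [cShiIsh, Finset.mem_union, Finset.mem_singleton, Finset.mem_image,
    Finset.mem_biUnion, Finset.mem_filter, Finset.mem_univ, true_and] at hH
  obtain ((rfl | ⟨p, -, rfl⟩) | ⟨p, -, rfl⟩) | ⟨p, -, c, -, rfl⟩ := hH
  · exact hker (π none)
  · exact hker (π (some p.1) - π (some p.2))
  · simpa [π, sub_eq_zero] using hker (π (some p.1) - π (some p.2) - π none)
  · simpa [π, sub_eq_zero] using hker (π (some p.1) - π (some p.2) - (c : ℝ) • π none)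

/-- The localization of the cone over the Shi-Ish arrangement at the flat
`z = 0`, `x_1 = x_{ℓ-1} = x_ℓ` is a `gridCone`. -/
lemma mem_loc_cShiIsh_iff {ℓ k : ℕ} (hℓ : 3 ≤ ℓ) (hk : 2 ≤ k) (hkl : k ≤ ℓ - 1)
    {r s t : Fin ℓ} (hr : (r : ℕ) = 0) (hs : (s : ℕ) = ℓ - 2) (ht : (t : ℕ) = ℓ - 1)
    {a b z : (Option (Fin ℓ) → ℝ) →ₗ[ℝ] ℝ} (ha : ∀ x, a x = x (some r) - x (some s))
    (hb : ∀ x, b x = x (some r) - x (some t)) (hz : ∀ x, z x = x none)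
    (H : Set (Option (Fin ℓ) → ℝ)) :
    H ∈ loc (cShiIsh ℓ k) {x | a x = 0 ∧ b x = 0 ∧ z x = 0} ↔ H ∈ gridCone a b z k := by
  have hrs : r < s := by rw [Fin.lt_def]; omega
  have hst : s < t := by rw [Fin.lt_def]; omega
  have hrt : r < t := hrs.trans hst
  have hdiff : ∀ x, b x - a x = x (some s) - x (some t) := fun x => by rw [ha, hb]; ring
  have hpair : ∀ p q : Fin ℓ, p < q →
      (∀ x : Option (Fin ℓ) → ℝ, a x = 0 ∧ b x = 0 ∧ z x = 0 → x (some p) = x (some q)) →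
      (p = r ∧ q = s) ∨ (p = r ∧ q = t) ∨ (p = s ∧ q = t) := by
    intro p q hpq h
    have h := h (fun o => o.elim 0 fun i => if i = r ∨ i = s ∨ i = t then 0 else (i : ℝ) + 1)
      (by simp [ha, hb, hz])
    have hp : (p : ℝ) + 1 ≠ 0 := by positivity
    have hq : (q : ℝ) + 1 ≠ 0 := by positivity
    have hpq' : (p : ℝ) + 1 ≠ q + 1 := by simpa [Fin.ext_iff] using hpq.ne
    simp only [Option.elim_some] at h
    rw [Fin.lt_def] at *
    split_ifs at h with h₁ h₂ h₂
    · simp only [Fin.ext_iff] at *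
      omega
    · exact absurd h.symm hq
    · exact absurd h hp
    · exact absurd h hpq'
  simp only [loc, cShiIsh, gridCone, Finset.mem_union, Finset.mem_singleton, Finset.mem_image,
    Finset.mem_biUnion, Finset.mem_filter, Finset.mem_univ, true_and, Finset.mem_Icc,
    Finset.bind_def, Finset.pure_def, Finset.mem_sup, hdiff]
  constructor
  · rintro ⟨((rfl | ⟨⟨p, q⟩, hpq, rfl⟩) | ⟨⟨p, q⟩, ⟨hpq, hkp⟩, rfl⟩) |
      ⟨⟨p, q⟩, hp, _, ⟨c, ⟨⟨hc₁, hcq⟩, hck⟩, rfl⟩, rfl⟩, hY⟩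
    · exact .inl (by simp only [hz])
    · obtain ⟨rfl, rfl⟩ | ⟨rfl, rfl⟩ | ⟨rfl, rfl⟩ := hpair p q hpq fun x hx =>
        sub_eq_zero.mp (hY hx)
      · exact .inr (.inl ⟨0, by omega, by simp [ha]⟩)
      · exact .inr (.inr (.inl ⟨0, by omega, by simp [hb]⟩))
      · exact .inr (.inr (.inr (.inl rfl)))
    · have hpq' := hpair p q hpq fun x hx => by
        have h₀ : x none = 0 := (hz x).symm.trans hx.2.2
        have h : x (some p) - x (some q) = x none := hY hx
        rwa [h₀, sub_eq_zero] at h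
      obtain ⟨rfl, rfl⟩ | ⟨rfl, rfl⟩ | ⟨rfl, rfl⟩ := hpq'
      · simp only at hkp
        omega
      · simp only at hkp
        omega
      · exact .inr (.inr (.inr (.inr (by simp only [hz]))))
    · have hpr : p = r := Fin.ext (hp.trans hr.symm)
      have hpq : p < q := by
        simp only [Fin.lt_def] at *
        omega
      have hpq' := hpair p q hpq fun x hx => by
        have h₀ : x none = 0 := (hz x).symm.trans hx.2.2
        have h : x (some p) - x (some q) = c * x none := hY hx
        rwa [h₀, mul_zero, sub_eq_zero] at h
      obtain ⟨rfl, rfl⟩ | ⟨rfl, rfl⟩ | ⟨rfl, rfl⟩ := hpq'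
      · exact .inr (.inl ⟨c, hck, by simp only [ha, hz]⟩)
      · exact .inr (.inr (.inl ⟨c, hck, by simp only [hb, hz]⟩))
      · exact absurd hpr hrs.ne'
  · rintro (rfl | ⟨c, hc, rfl⟩ | ⟨c, hc, rfl⟩ | rfl | rfl)
    · exact ⟨.inl (.inl (.inl (by simp only [hz]))), fun x hx => hx.2.2⟩
    · refine ⟨?_, fun x hx => by simp [hx.1, hx.2.2]⟩
      obtain rfl | hc₀ := Nat.eq_zero_or_pos c
      · exact .inl (.inl (.inr ⟨(r, s), hrs, by simp [ha]⟩))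
      · exact .inr ⟨(r, s), hr, c, ⟨c, ⟨⟨hc₀, by simp only; omega⟩, hc⟩, rfl⟩,
          by simp only [ha, hz]⟩
    · refine ⟨?_, fun x hx => by simp [hx.2.1, hx.2.2]⟩
      obtain rfl | hc₀ := Nat.eq_zero_or_pos c
      · exact .inl (.inl (.inr ⟨(r, t), hrt, by simp [hb]⟩))
      · exact .inr ⟨(r, t), hr, c, ⟨c, ⟨⟨hc₀, by simp only; omega⟩, hc⟩, rfl⟩,
          by simp only [hb, hz]⟩
    · exact ⟨.inl (.inl (.inr ⟨(s, t), hst, rfl⟩)), fun x hx => by simp [← hdiff, hx.1, hx.2.1]⟩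
    · exact ⟨.inl (.inr ⟨(s, t), ⟨hst, by simp only; omega⟩, by simp only [hz]⟩),
        fun x hx => by simp [← hdiff, hx.1, hx.2.1, hx.2.2]⟩

end Paper

open Paper in
/-- For `ℓ ≥ 3` and `2 ≤ k ≤ ℓ-1`, the cone over the (k,ℓ)-Shi-Ish
arrangement is not supersolvable. -/
theorem shi_ish_cone_not_supersolvable (ℓ k : ℕ) (hℓ : 3 ≤ ℓ) (hk : 2 ≤ k)
    (hkl : k ≤ ℓ - 1) :
    ¬ IsSupersolvable (cShiIsh ℓ k) := by
  intro hsolv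
  let r : Fin ℓ := ⟨0, by omega⟩
  let s : Fin ℓ := ⟨ℓ - 2, by omega⟩
  let t : Fin ℓ := ⟨ℓ - 1, by omega⟩
  let π (o : Option (Fin ℓ)) : (Option (Fin ℓ) → ℝ) →ₗ[ℝ] ℝ := LinearMap.proj o
  let a := π (some r) - π (some s)
  let b := π (some r) - π (some t)
  have hmem : ∀ H, H ∈ loc (cShiIsh ℓ k) {x | a x = 0 ∧ b x = 0 ∧ π none x = 0} ↔
      H ∈ gridCone a b (π none) k :=
    mem_loc_cShiIsh_iff hℓ hk hkl rfl rfl rfl (fun _ => rfl) (fun _ => rfl) (fun _ => rfl)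
  obtain ⟨V, hV, hmod⟩ := hsolv.exists_submodule_of_loc exists_submodule_of_mem_cShiIsh _
    ⟨_, (hmem _).mpr (.inl rfl)⟩
  simp only [hmem] at hV hmod
  refine gridCone_not_modular hk (fun p q w => ?_) V hV hmod
  have hrs : r ≠ s := by simp [r, s, Fin.ext_iff]; omega
  have hrt : r ≠ t := by simp [r, t, Fin.ext_iff]; omega
  have hst : s ≠ t := by simp [s, t, Fin.ext_iff]; omega
  refine ⟨fun o => o.elim w fun i => if i = s then -p else if i = t then -q else 0, ?_, ?_, ?_⟩
  · simp [a, π, hrs, hrt]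
  · simp [b, π, hrs, hrt, hst.symm]
  · simp [π]
end
end

section
/- Let (G,ψ) be a vertex-weighted digraph on [ℓ] and let v be a coking of G. Let (G′,ψ′) be obtained from (G,ψ) by the coking elimination operation with respect to v. If Condition (C) with respect to v is satisfied, then the ψ-digraphical arrangements A(G,ψ) and A(G′,ψ′) have the same characteristic polynomial: χ_{A(G,ψ)}(t) = χ_{A(G′,ψ′)}(t). -/
open scoped Classical
open Finset

noncomputable section

namespace Paper

variable {ι : Type}

/-- The difference equation `x_i - x_j = c` encoded as `(i, j, c)`, where the coordinate
indexed by `none` is fixed to be `0`. -/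
abbrev DiffEq (ι : Type) := Option ι × Option ι × ℤ

/-- Extend a vector by the coordinate `0` at `none`. -/
def hat {R : Type*} [Zero R] (x : ι → R) : Option ι → R := fun o => o.elim 0 x

/-- `x` satisfies the difference equation `e` over the ring `R`. -/
def Sat {R : Type*} [Ring R] (e : DiffEq ι) (x : ι → R) : Prop :=
  hat x e.1 - hat x e.2.1 = (e.2.2 : R)

/-- The real solution set of a difference equation. -/
def hyp (e : DiffEq ι) : Set (ι → ℝ) := {x | Sat e x}

/-- The equivalence relation on coordinates generated by a set of difference equations. -/
def compSetoid (F : Finset (DiffEq ι)) : Setoid (Option ι) :=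
  Relation.EqvGen.setoid fun o p => ∃ e ∈ F, e.1 = o ∧ e.2.1 = p

/-- The classes of coordinates not linked to the constant coordinate. -/
abbrev FreeComp (F : Finset (DiffEq ι)) :=
  {c : Quotient (compSetoid F) // c ≠ Quotient.mk (compSetoid F) none}

/-- The solutions of the homogeneous system attached to `F`. -/
def homSol (R : Type*) [CommRing R] (F : Finset (DiffEq ι)) : Submodule R (ι → R) where
  carrier := {y | ∀ e ∈ F, hat y e.1 = hat y e.2.1}
  add_mem' := by
    intro y z hy hz e he
    have h : ∀ o, hat (y + z) o = hat y o + hat z o := by rintro (_ | i) <;> simp [hat]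
    rw [h, h, hy e he, hz e he]
  zero_mem' := by
    intro e _
    have h : ∀ o, hat (0 : ι → R) o = 0 := by rintro (_ | i) <;> simp [hat]
    rw [h, h]
  smul_mem' := by
    intro r y hy e he
    have h : ∀ o, hat (r • y) o = r * hat y o := by rintro (_ | i) <;> simp [hat]
    rw [h, h, hy e he]

lemma hat_eq_of_rel {R : Type*} [CommRing R] {F : Finset (DiffEq ι)} {y : ι → R}
    (hy : y ∈ homSol R F) {o p : Option ι} (h : compSetoid F o p) : hat y o = hat y p := by
  change Relation.EqvGen _ o p at h
  induction h with
  | rel _ _ h => obtain ⟨e, he, rfl, rfl⟩ := h; exact hy e he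
  | refl => rfl
  | symm _ _ _ ih => exact ih.symm
  | trans _ _ _ _ _ ih₁ ih₂ => exact ih₁.trans ih₂

/-- Homogeneous solutions are free functions on the free components. -/
def homSolEquiv (R : Type*) [CommRing R] (F : Finset (DiffEq ι)) :
    homSol R F ≃ₗ[R] (FreeComp F → R) where
  toFun y c := Quotient.lift (hat y.1) (fun _ _ h => hat_eq_of_rel y.2 h) c.1
  map_add' y z := by
    funext ⟨c, hc⟩
    induction c using Quotient.inductionOn with
    | _ o => cases o <;> simp [hat]
  map_smul' r y := by
    funext ⟨c, hc⟩
    induction c using Quotient.inductionOn with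
    | _ o => cases o <;> simp [hat]
  invFun g := ⟨fun i => if h : Quotient.mk (compSetoid F) (some i) ≠ Quotient.mk _ none
      then g ⟨_, h⟩ else 0, by
    intro e he
    have key : ∀ o : Option ι, hat (fun i => if h : Quotient.mk (compSetoid F) (some i) ≠
        Quotient.mk _ none then g ⟨_, h⟩ else 0) o =
        if h : Quotient.mk (compSetoid F) o ≠ Quotient.mk _ none then g ⟨_, h⟩ else 0 := by
      rintro (_ | i)
      · simp [hat]
      · rfl
    rw [key, key]
    have : Quotient.mk (compSetoid F) e.1 = Quotient.mk (compSetoid F) e.2.1 :=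
      Quotient.sound (Relation.EqvGen.rel _ _ ⟨e, he, rfl, rfl⟩)
    rw [this]⟩
  left_inv y := by
    ext i
    by_cases h : Quotient.mk (compSetoid F) (some i) = Quotient.mk _ none
    · have := hat_eq_of_rel y.2 (Quotient.exact h)
      simp only [h, ne_eq, not_true_eq_false, dite_false]
      exact this.symm
    · simp only [ne_eq, h, not_false_eq_true, dite_true]
      rfl
  right_inv g := by
    funext ⟨c, hc⟩
    induction c using Quotient.inductionOn with
    | _ o =>
      cases o with
      | none => exact absurd rfl hc
      | some i =>
        change (if h : _ then _ else _) = _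
        rw [dif_pos hc]

lemma sat_add_iff {R : Type*} [CommRing R] {e : DiffEq ι} {x : ι → R} (hx : Sat e x)
    (y : ι → R) : Sat e (y + x) ↔ hat y e.1 = hat y e.2.1 := by
  have h : ∀ o, hat (y + x) o = hat y o + hat x o := by rintro (_ | i) <;> simp [hat]
  unfold Sat at hx ⊢
  rw [h, h, ← hx, ← sub_eq_zero, ← sub_eq_zero (a := hat y e.1)]
  congr! 1
  ring

lemma sat_map_cast {R : Type*} [Ring R] {e : DiffEq ι} {x : ι → ℤ} (hx : Sat e x) :
    Sat e (fun i => (x i : R)) := by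
  have h : ∀ o, hat (fun i => (x i : R)) o = ((hat x o : ℤ) : R) := by
    rintro (_ | i) <;> simp [hat]
  unfold Sat at hx ⊢
  rw [h, h, ← Int.cast_sub, hx, Int.cast_id]

lemma sat_real_cast_iff {e : DiffEq ι} {x : ι → ℤ} :
    Sat e (fun i => (x i : ℝ)) ↔ Sat e x := by
  refine ⟨fun hx => ?_, sat_map_cast⟩
  have h : ∀ o, hat (fun i => (x i : ℝ)) o = ((hat x o : ℤ) : ℝ) := by
    rintro (_ | i) <;> simp [hat]
  unfold Sat at hx ⊢
  rw [h, h] at hx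
  exact_mod_cast hx

lemma sat_floor {e : DiffEq ι} {x : ι → ℝ} (hx : Sat e x) : Sat e (fun i => ⌊x i⌋) := by
  have h : ∀ o, hat (fun i => ⌊x i⌋) o = ⌊hat x o⌋ := by
    rintro (_ | i) <;> simp [hat]
  unfold Sat at hx ⊢
  rw [h, h, sub_eq_iff_eq_add.mp hx]
  simp

lemma mem_L_iff {A : Finset (Set (ι → ℝ))} {X : Set (ι → ℝ)} :
    X ∈ L A ↔ (∃ B ⊆ A, inter B = X) ∧ X.Nonempty := by
  simp [L]

lemma sum_mob {A : Finset (Set (ι → ℝ))} {Z : Set (ι → ℝ)} (hZ : Z ∈ L A) :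
    ∑ X ∈ (L A).filter (fun X => Z ⊆ X), mob A X = if Z = Set.univ then 1 else 0 := by
  have hfil : (L A).filter (fun X => Z ⊆ X) = insert Z (above A Z) := by
    ext X
    simp only [above, mem_filter, mem_insert]
    constructor
    · rintro ⟨hX, h⟩
      rcases h.eq_or_ssubset with h | h
      · exact Or.inl h.symm
      · exact Or.inr ⟨hX, h⟩
    · rintro (rfl | h)
      · exact ⟨hZ, subset_rfl⟩
      · exact ⟨h.1, h.2.subset⟩
  have hnot : Z ∉ above A Z := by simp [above]
  rw [hfil, sum_insert hnot, mob]
  split_ifs with h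
  · have : above A Z = ∅ := by
      rw [above, filter_eq_empty_iff]
      intro X _ hX
      exact hX.2 (h ▸ Set.subset_univ X)
    simp [this]
  · rw [sum_attach (above A Z) (mob A)]
    simp

lemma hyp_ne_univ {e : DiffEq ι} (he : e.1 ≠ e.2.1) : hyp e ≠ Set.univ := by
  intro h
  have hs : ∀ x : ι → ℝ, Sat e x := fun x => (h ▸ Set.mem_univ x : x ∈ hyp e)
  obtain ⟨o, p, c⟩ := e
  have h0 := hs 0
  rcases o with _ | i
  · rcases p with _ | j
    · exact he rfl
    · have h1 := hs (Pi.single j 1)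
      simp [Sat, hat] at h0 h1
      rw [← h0] at h1
      simp at h1
  · have h1 := hs (Pi.single i 1)
    rcases p with _ | j
    · simp [Sat, hat] at h0 h1
      rw [← h0] at h1
      simp at h1
    · have hij : j ≠ i := fun h => he (by simp [h])
      simp [Sat, hat, hij] at h0 h1
      rw [← h0] at h1
      simp at h1

lemma intCast_ne_iff {q : ℕ} {m n : ℤ} (h : |m - n| < q) :
    (m : ZMod q) ≠ (n : ZMod q) ↔ m ≠ n := by
  refine not_congr ⟨fun hmn => ?_, fun hmn => by rw [hmn]⟩
  rw [← sub_eq_zero, ← Int.cast_sub, ZMod.intCast_zmod_eq_zero_iff_dvd] at hmn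
  exact sub_eq_zero.mp (Int.eq_zero_of_abs_lt_dvd hmn h)

variable [Fintype ι]

lemma dim_eq_card_freeComp {F : Finset (DiffEq ι)} {x₀ : ι → ℝ} (hx₀ : ∀ e ∈ F, Sat e x₀) :
    dim {x : ι → ℝ | ∀ e ∈ F, Sat e x} = Fintype.card (FreeComp F) := by
  have hset : {x : ι → ℝ | ∀ e ∈ F, Sat e x} =
      (AffineSubspace.mk' x₀ (homSol ℝ F) : Set (ι → ℝ)) := by
    ext x
    rw [SetLike.mem_coe, AffineSubspace.mem_mk', vsub_eq_sub]
    refine forall₂_congr fun e he => ?_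
    rw [← sat_add_iff (hx₀ e he), sub_add_cancel]
  rw [dim, hset, AffineSubspace.affineSpan_coe, AffineSubspace.direction_mk',
    (homSolEquiv ℝ F).finrank_eq, Module.finrank_fintype_fun_eq_card]

lemma card_sat_zmod {F : Finset (DiffEq ι)} {x₀ : ι → ℝ} (hx₀ : ∀ e ∈ F, Sat e x₀)
    (q : ℕ) [NeZero q] :
    (univ.filter fun x : ι → ZMod q => ∀ e ∈ F, Sat e x).card =
      q ^ dim {x : ι → ℝ | ∀ e ∈ F, Sat e x} := by
  set z : ι → ZMod q := fun i => (⌊x₀ i⌋ : ZMod q)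
  have hz : ∀ e ∈ F, Sat e z := fun e he => sat_map_cast (sat_floor (hx₀ e he))
  have e₁ : {x : ι → ZMod q // ∀ e ∈ F, Sat e x} ≃ homSol (ZMod q) F :=
    (Equiv.subRight z).subtypeEquiv fun x => by
      refine forall₂_congr fun e he => ?_
      rw [Equiv.subRight_apply, ← sat_add_iff (hz e he), sub_add_cancel]
  rw [dim_eq_card_freeComp hx₀, ← Fintype.card_subtype,
    Fintype.card_congr (e₁.trans (homSolEquiv (ZMod q) F).toEquiv)]
  simp [ZMod.card]

lemma exists_int_lift {M q : ℕ} [NeZero q] (hq : (Fintype.card ι + 1) * M < q)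
    (x : ι → ZMod q) : ∃ x' : ι → ℤ, ∀ e : DiffEq ι, |e.2.2| ≤ M → (Sat e x' ↔ Sat e x) := by
  obtain ⟨s, hs⟩ : ∃ s : ZMod q, ∀ o : Option ι, ∀ k < M, s ≠ hat x o - (k : ZMod q) := by
    by_contra! hcon
    have hsub : (univ : Finset (ZMod q)) ⊆
        ((univ : Finset (Option ι)) ×ˢ range M).image fun p => hat x p.1 - (p.2 : ZMod q) := by
      intro s _
      obtain ⟨o, k, hk, hs⟩ := hcon s
      exact mem_image.mpr ⟨(o, k), by simpa using hk, hs.symm⟩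
    have h := (card_le_card hsub).trans card_image_le
    rw [card_product, card_univ, card_univ, ZMod.card, card_range, Fintype.card_option] at h
    omega
  set r : Option ι → ℤ := fun o => ((hat x o - s).val : ℤ) with hr
  have hcast : ∀ o, (r o : ZMod q) = hat x o - s := fun o => by simp [hr]
  have hub : ∀ o, r o < q := fun o =>
    Int.ofNat_lt.mpr (ZMod.val_lt (hat x o - s))
  have hlb : ∀ o, (M : ℤ) ≤ r o := by
    intro o
    by_contra! hlt
    refine hs o (hat x o - s).val (Int.ofNat_lt.mp hlt) ?_
    rw [ZMod.natCast_zmod_val]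
    ring
  refine ⟨fun i => r (some i) - r none, fun e he => ?_⟩
  have hh : ∀ o, hat (fun i => r (some i) - r none) o = r o - r none := by
    rintro (_ | i) <;> simp [hat]
  have hiff : ((q : ℤ) ∣ r e.1 - r e.2.1 - e.2.2) ↔ Sat e x := by
    rw [← ZMod.intCast_zmod_eq_zero_iff_dvd]
    push_cast
    rw [hcast, hcast, sub_eq_zero, Sat]
    congr! 1
    ring
  rw [← hiff, Sat, hh, hh, Int.cast_id]
  constructor
  · intro h
    have : r e.1 - r e.2.1 - e.2.2 = 0 := by linarith
    simp [this]
  · intro h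
    have := Int.eq_zero_of_abs_lt_dvd h (by
      have h1 := hub e.1; have h2 := hub e.2.1; have h3 := hlb e.1; have h4 := hlb e.2.1
      rw [abs_le] at he
      rw [abs_lt]
      constructor <;> linarith [he.1, he.2])
    linarith

/-- The finite field method for arrangements of difference equations. -/
theorem eval_charPoly_image_hyp (F : Finset (DiffEq ι)) (hne : ∀ e ∈ F, hyp e ≠ Set.univ)
    {M q : ℕ} [NeZero q] (hM : ∀ e ∈ F, |e.2.2| ≤ M) (hq : (Fintype.card ι + 1) * M < q) :
    (charPoly (F.image hyp)).eval (q : ℤ) =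
      (univ.filter fun x : ι → ZMod q => ∀ e ∈ F, ¬ Sat e x).card := by
  choose lift hlift using exists_int_lift (ι := ι) hq
  let pt : (ι → ZMod q) → ι → ℝ := fun x i => (lift x i : ℝ)
  have hpt : ∀ x, ∀ e ∈ F, pt x ∈ hyp e ↔ Sat e x := fun x e he =>
    sat_real_cast_iff.trans (hlift x e (hM e he))
  have hflat : ∀ X ∈ L (F.image hyp), X = {y | ∀ e ∈ F.filter (fun e => X ⊆ hyp e), Sat e y} := by
    intro X hX
    obtain ⟨⟨B, hB, rfl⟩, -⟩ := mem_L_iff.mp hX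
    refine Set.Subset.antisymm (fun y hy e he => (mem_filter.mp he).2 hy) fun y hy => ?_
    refine Set.mem_iInter₂.mpr fun H hH => ?_
    obtain ⟨e, he, rfl⟩ := mem_image.mp (hB hH)
    exact hy e (mem_filter.mpr ⟨he, Set.iInter₂_subset _ hH⟩)
  have hcount : ∀ X ∈ L (F.image hyp),
      ((q : ℤ) ^ dim X) = ∑ x : ι → ZMod q, if pt x ∈ X then 1 else 0 := by
    intro X hX
    obtain ⟨x₀, hx₀⟩ := (mem_L_iff.mp hX).2
    have h := card_sat_zmod (F := F.filter fun e => X ⊆ hyp e) (x₀ := x₀)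
      (fun e he => (mem_filter.mp he).2 hx₀) q
    rw [← hflat X hX] at h
    rw [sum_boole, ← Nat.cast_pow, ← h]
    congr 2
    refine filter_congr fun x _ => ?_
    conv_rhs => rw [hflat X hX]
    exact forall₂_congr fun e he => (hpt x e (mem_filter.mp he).1).symm
  have hinner : ∀ x : ι → ZMod q, ∑ X ∈ (L (F.image hyp)).filter (fun X => pt x ∈ X),
      mob (F.image hyp) X = if ∀ e ∈ F, ¬ Sat e x then 1 else 0 := by
    intro x
    set Z : Set (ι → ℝ) := inter ((F.filter fun e => Sat e x).image hyp) with hZdef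
    have hmem : ∀ y, y ∈ Z ↔ ∀ e ∈ F, Sat e x → y ∈ hyp e := by
      intro y
      simp only [hZdef, inter, Set.mem_iInter₂]
      constructor
      · exact fun h e he hs => h _ (mem_image_of_mem _ (mem_filter.mpr ⟨he, hs⟩))
      · intro h H hH
        obtain ⟨e, he, rfl⟩ := mem_image.mp hH
        exact h e (mem_filter.mp he).1 (mem_filter.mp he).2
    have hxZ : pt x ∈ Z := (hmem _).mpr fun e he hs => (hpt x e he).mpr hs
    have hZ : Z ∈ L (F.image hyp) :=
      mem_L_iff.mpr ⟨⟨_, image_subset_image (filter_subset _ _), rfl⟩, ⟨_, hxZ⟩⟩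
    have hfil : (L (F.image hyp)).filter (fun X => pt x ∈ X) =
        (L (F.image hyp)).filter (fun X => Z ⊆ X) := by
      refine filter_congr fun X hX => ⟨fun h y hy => ?_, fun h => h hxZ⟩
      rw [hflat X hX]
      intro e he
      obtain ⟨he, hXe⟩ := mem_filter.mp he
      exact (hmem y).mp hy e he ((hpt x e he).mp (hXe h))
    rw [hfil, sum_mob hZ]
    congr 1
    refine propext ⟨fun h e he hs => hne e he ?_, fun h => ?_⟩
    · exact Set.eq_univ_of_forall fun y => (hmem y).mp (h ▸ Set.mem_univ y) e he hs
    · exact Set.eq_univ_of_forall fun y => (hmem y).mpr fun e he hs => absurd hs (h e he)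
  calc (charPoly (F.image hyp)).eval (q : ℤ)
      = ∑ X ∈ L (F.image hyp), mob (F.image hyp) X * (q : ℤ) ^ dim X := by
        simp [charPoly, Polynomial.eval_finsetSum]
    _ = ∑ X ∈ L (F.image hyp), ∑ x : ι → ZMod q,
          if pt x ∈ X then mob (F.image hyp) X else 0 := by
        refine sum_congr rfl fun X hX => ?_
        rw [hcount X hX, mul_sum]
        simp
    _ = ∑ x : ι → ZMod q, if ∀ e ∈ F, ¬ Sat e x then (1 : ℤ) else 0 := by
        rw [sum_comm]
        refine sum_congr rfl fun x _ => ?_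
        rw [← sum_filter, hinner x]
    _ = _ := by rw [sum_boole]

/-- The difference equations defining the ψ-digraphical arrangement. -/
def digEqs (E : Finset (ι × ι)) (a b : ι → ℤ) : Finset (DiffEq ι) :=
  ((univ.filter fun p : ι × ι => p.1 ≠ p.2).image fun p => (some p.1, some p.2, 0))
  ∪ (E.image fun p => (some p.1, some p.2, 1))
  ∪ (univ.biUnion fun i : ι => (Finset.Icc (a i) (b i)).image fun c => (some i, none, c))

lemma image_hyp_digEqs (E : Finset (ι × ι)) (a b : ι → ℤ) :
    (digEqs E a b).image hyp = digArr E a b := by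
  simp only [digEqs, digArr, image_union, image_image, biUnion_image]
  congr! 6 <;> simp [hyp, Sat, hat, Function.comp_def, image_image]

lemma forall_mem_digEqs {E : Finset (ι × ι)} {a b : ι → ℤ} {P : DiffEq ι → Prop} :
    (∀ e ∈ digEqs E a b, P e) ↔ (∀ i j, i ≠ j → P (some i, some j, 0)) ∧
      (∀ i j, (i, j) ∈ E → P (some i, some j, 1)) ∧
      ∀ i, ∀ c ∈ Finset.Icc (a i) (b i), P (some i, none, c) := by
  constructor
  · intro h
    refine ⟨fun i j hij => h _ ?_, fun i j hij => h _ ?_, fun i c hc => h _ ?_⟩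
    · exact mem_union_left _ (mem_union_left _ (mem_image.mpr ⟨(i, j), by simpa using hij, rfl⟩))
    · exact mem_union_left _ (mem_union_right _ (mem_image.mpr ⟨(i, j), hij, rfl⟩))
    · exact mem_union_right _ (mem_biUnion.mpr ⟨i, mem_univ _, mem_image.mpr ⟨c, hc, rfl⟩⟩)
  · rintro ⟨h1, h2, h3⟩ e he
    rcases mem_union.mp he with he | he
    · rcases mem_union.mp he with he | he
      · obtain ⟨p, hp, rfl⟩ := mem_image.mp he
        exact h1 _ _ (mem_filter.mp hp).2
      · obtain ⟨p, hp, rfl⟩ := mem_image.mp he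
        exact h2 _ _ hp
    · obtain ⟨i, -, hi⟩ := mem_biUnion.mp he
      obtain ⟨c, hc, rfl⟩ := mem_image.mp hi
      exact h3 i c hc

/-- The integer points of the box `∏ (b i, q + a i)` off the hyperplanes `x_i = x_j` and
off the hyperplanes `x_i = x_j + 1` given by the edges. -/
def boxPoints (E : Finset (ι × ι)) (a b : ι → ℤ) (q : ℤ) : Finset (ι → ℤ) :=
  (Fintype.piFinset fun i => Finset.Ioo (b i) (q + a i)).filter fun y =>
    (∀ i j, i ≠ j → y i ≠ y j) ∧ ∀ i j, (i, j) ∈ E → y i ≠ y j + 1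

lemma mem_boxPoints {E : Finset (ι × ι)} {a b : ι → ℤ} {q : ℤ} {y : ι → ℤ} :
    y ∈ boxPoints E a b q ↔ (∀ i, b i < y i ∧ y i < q + a i) ∧
      (∀ i j, i ≠ j → y i ≠ y j) ∧ ∀ i j, (i, j) ∈ E → y i ≠ y j + 1 := by
  simp [boxPoints]

lemma avoid_intCast_iff {E : Finset (ι × ι)} {a b : ι → ℤ} {q : ℕ}
    (h0 : ∀ i, (0 : ℤ) ∈ Finset.Icc (a i) (b i)) (hb : ∀ i, b i < q) (ha : ∀ i, -(q : ℤ) < a i)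
    {y : ι → ℤ} (hy : ∀ i, 0 ≤ y i ∧ y i < q) :
    (∀ e ∈ digEqs E a b, ¬ Sat e fun i => (y i : ZMod q)) ↔ y ∈ boxPoints E a b q := by
  have h0' : ∀ i, a i ≤ 0 ∧ 0 ≤ b i := fun i => Finset.mem_Icc.mp (h0 i)
  have hbox : (∀ i, ∀ c ∈ Finset.Icc (a i) (b i), (y i : ZMod q) ≠ (c : ZMod q)) ↔
      ∀ i, b i < y i ∧ y i < q + a i := by
    refine forall_congr' fun i => ⟨fun h => ?_, fun h c hc => ?_⟩
    · have := hy i; have := h0' i; have := hb i; have := ha i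
      constructor
      · by_contra! hlt
        exact h (y i) (Finset.mem_Icc.mpr ⟨by omega, hlt⟩) rfl
      · by_contra! hlt
        refine h (y i - q) (Finset.mem_Icc.mpr ⟨by omega, by omega⟩) ?_
        simp
    · rw [Finset.mem_Icc] at hc
      have := hy i; have := h0' i
      refine (intCast_ne_iff ?_).mpr ?_
      · rw [abs_lt]; omega
      · omega
  rw [forall_mem_digEqs, mem_boxPoints, ← hbox]
  simp only [Sat, hat, Option.elim_some, Option.elim_none, sub_zero, Int.cast_zero, Int.cast_one,
    sub_eq_iff_eq_add, zero_add]
  have hne : ∀ i j, ((y i : ZMod q) ≠ y j ↔ y i ≠ y j) := fun i j => by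
    have := hy i; have := hy j
    exact intCast_ne_iff (by rw [abs_lt]; omega)
  constructor
  · rintro ⟨h1, h2, h3⟩
    exact ⟨h3, fun i j hij => (hne i j).mp (h1 i j hij), fun i j hij h => h2 i j hij (by
      rw [h]; push_cast; ring)⟩
  · rintro ⟨h3, h1, h2⟩
    refine ⟨fun i j hij => (hne i j).mpr (h1 i j hij), fun i j hij => ?_, h3⟩
    have hi := hbox.mp h3 i; have hj := hbox.mp h3 j
    have := h0' i; have := h0' j
    have := (intCast_ne_iff (q := q) (m := y i) (n := y j + 1)
      (by rw [abs_lt]; omega)).mpr (h2 i j hij)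
    rwa [Int.cast_add, Int.cast_one, add_comm] at this

lemma card_avoid_eq_card_boxPoints {E : Finset (ι × ι)} {a b : ι → ℤ} {q : ℕ} [NeZero q]
    (h0 : ∀ i, (0 : ℤ) ∈ Finset.Icc (a i) (b i)) (hb : ∀ i, b i < q)
    (ha : ∀ i, -(q : ℤ) < a i) :
    (univ.filter fun x : ι → ZMod q => ∀ e ∈ digEqs E a b, ¬ Sat e x).card =
      (boxPoints E a b q).card := by
  have hval : ∀ x : ι → ZMod q, (fun i => ((((x i).val : ℕ) : ℤ) : ZMod q)) = x := fun x => by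
    simp
  refine card_bij' (fun x _ i => ((x i).val : ℤ)) (fun y _ i => (y i : ZMod q)) ?_ ?_ ?_ ?_
  · intro x hx
    refine (avoid_intCast_iff h0 hb ha fun i => ?_).mp ?_
    · exact ⟨by positivity, by exact_mod_cast ZMod.val_lt _⟩
    · rw [hval]
      exact (mem_filter.mp hx).2
  · intro y hy
    refine mem_filter.mpr ⟨mem_univ _, (avoid_intCast_iff h0 hb ha fun i => ?_).mpr hy⟩
    have := (mem_boxPoints.mp hy).1 i
    have := Finset.mem_Icc.mp (h0 i)
    omega
  · intro x _
    exact hval x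
  · intro y hy
    funext i
    have := (mem_boxPoints.mp hy).1 i
    have := Finset.mem_Icc.mp (h0 i)
    rw [ZMod.val_intCast]
    exact Int.emod_eq_of_lt (by omega) (by omega)

/-- Closing the gap after `v` matches the box points before and after eliminating `v`. -/
lemma card_boxPoints_ceo {E : Finset (ι × ι)} {a b : ι → ℤ} {v : ι} {q : ℤ}
    (hcoking : ∀ u, u ≠ v → (u, v) ∈ E) (ha : ∀ i, a v ≤ a i) (hb : ∀ i, b i ≤ b v + 1) :
    (boxPoints E a b q).card = (boxPoints (E.filter fun e => e.2 ≠ v)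
      (fun i => if i = v then a v else a i - 1) b q).card := by
  refine card_bij' (fun y _ i => if y v < y i then y i - 1 else y i)
    (fun y _ i => if y v < y i then y i + 1 else y i) ?_ ?_ ?_ ?_
  · intro y hy
    obtain ⟨h1, h2, h3⟩ := mem_boxPoints.mp hy
    refine mem_boxPoints.mpr ⟨fun i => ?_, fun i j hij => ?_, fun i j hij => ?_⟩
    · by_cases hi : i = v
      · subst hi; simpa using h1 i
      · have := h1 i; have := h1 v; have := h2 i v hi; have := h3 i v (hcoking i hi)
        have := ha i; have := hb i
        simp only [hi, if_false]
        split_ifs <;> omega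
    · have := h2 i j hij
      have hi : i ≠ v → y i ≠ y v + 1 := fun h => h3 i v (hcoking i h)
      have hj : j ≠ v → y j ≠ y v + 1 := fun h => h3 j v (hcoking j h)
      grind
    · obtain ⟨hE, hj⟩ := mem_filter.mp hij
      have := h3 i j hE
      have := h2 j v hj
      have hi : i ≠ v → y i ≠ y v + 1 := fun h => h3 i v (hcoking i h)
      by_cases hiv : i = v
      · subst hiv
        grind
      · have := h2 i v hiv
        grind
  · intro y hy
    obtain ⟨h1, h2, h3⟩ := mem_boxPoints.mp hy
    refine mem_boxPoints.mpr ⟨fun i => ?_, fun i j hij => ?_, fun i j hij => ?_⟩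
    · by_cases hi : i = v
      · subst hi; simpa using h1 i
      · have h1i := h1 i; have := h1 v; have := hb i
        simp only [hi, if_false] at h1i
        split_ifs <;> omega
    · have := h2 i j hij
      grind
    · by_cases hj : j = v
      · subst hj
        grind
      · have := h3 i j (mem_filter.mpr ⟨hij, hj⟩)
        have := h2 j v hj
        grind
  · intro y hy
    obtain ⟨-, h2, h3⟩ := mem_boxPoints.mp hy
    funext i
    have hi : i ≠ v → y i ≠ y v + 1 := fun h => h3 i v (hcoking i h)
    grind
  · intro y _
    funext i
    grind

lemma eval_charPoly_digArr {E : Finset (ι × ι)} (hE : ∀ e ∈ E, e.1 ≠ e.2) {a b : ι → ℤ}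
    (h0 : ∀ i, (0 : ℤ) ∈ Finset.Icc (a i) (b i)) {M q : ℕ} (hM1 : 1 ≤ M)
    (hM : ∀ i, -(M : ℤ) ≤ a i ∧ b i ≤ M) (hq : (Fintype.card ι + 1) * M < q) :
    (charPoly (digArr E a b)).eval (q : ℤ) = (boxPoints E a b q).card := by
  have hMq : M < q := lt_of_le_of_lt (Nat.le_mul_of_pos_left M (Nat.succ_pos _)) hq
  have : NeZero q := ⟨by omega⟩
  rw [← image_hyp_digEqs, eval_charPoly_image_hyp (digEqs E a b) (M := M) _ _ hq,
    card_avoid_eq_card_boxPoints h0]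
  · intro i; have := hM i; omega
  · intro i; have := hM i; omega
  · refine forall_mem_digEqs.mpr ⟨fun i j hij => hyp_ne_univ (by simpa using hij),
      fun i j hij => hyp_ne_univ (by simpa using hE _ hij), fun i c _ => hyp_ne_univ (by simp)⟩
  · refine forall_mem_digEqs.mpr ⟨fun i j _ => by simp, fun i j _ => by simpa using hM1,
      fun i c hc => ?_⟩
    rw [Finset.mem_Icc] at hc
    have := hM i
    exact abs_le.mpr ⟨by simp only; omega, by simp only; omega⟩

end Paper

open Paper in
/-- the coking elimination operation preserves the characteristic
polynomial of ψ-digraphical arrangements, under Condition (C). -/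
theorem ceo_charPoly (ℓ : ℕ) (E : Finset (Fin ℓ × Fin ℓ)) (hE : ∀ e ∈ E, e.1 ≠ e.2)
    (a b : Fin ℓ → ℤ) (v : Fin ℓ)
    (hcoking : ∀ u : Fin ℓ, u ≠ v → (u, v) ∈ E)
    (hC0 : ∀ i : Fin ℓ, (0 : ℤ) ∈ Finset.Icc (a i) (b i))
    (hC1 : ∀ i : Fin ℓ, i ≠ v → Finset.Icc (a i) (b i - 1) ⊆ Finset.Icc (a v) (b v)) :
    charPoly (digArr E a b)
      = charPoly (digArr (E.filter fun e => e.2 ≠ v)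
          (fun i => if i = v then a v else a i - 1) b) := by
  have hC0' : ∀ i, a i ≤ 0 ∧ 0 ≤ b i := fun i => Finset.mem_Icc.mp (hC0 i)
  have hab : ∀ i, a v ≤ a i ∧ b i ≤ b v + 1 := by
    intro i
    by_cases hi : i = v
    · subst hi; omega
    · have := hC0' i
      have := hC0' v
      rcases le_or_gt (a i) (b i - 1) with h | h
      · have hl := Finset.mem_Icc.mp (hC1 i hi (Finset.left_mem_Icc.mpr h))
        have hr := Finset.mem_Icc.mp (hC1 i hi (Finset.right_mem_Icc.mpr h))
        omega
      · omega
  set M : ℕ := 1 + ∑ i, ((a i).natAbs + (b i).natAbs)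
  have hM : ∀ i, -(M : ℤ) ≤ a i - 1 ∧ b i ≤ M := by
    intro i
    have := single_le_sum (f := fun i => (a i).natAbs + (b i).natAbs) (fun _ _ => Nat.zero_le _)
      (mem_univ i)
    omega
  have hE' : ∀ e ∈ E.filter (fun e => e.2 ≠ v), e.1 ≠ e.2 := fun e he => hE e (mem_filter.mp he).1
  have hC0'' : ∀ i, (0 : ℤ) ∈ Finset.Icc (if i = v then a v else a i - 1) (b i) := by
    intro i
    have := hC0' i
    have := hC0' v
    rw [Finset.mem_Icc]
    split_ifs <;> omega
  have hM' : ∀ i, -(M : ℤ) ≤ (if i = v then a v else a i - 1) ∧ b i ≤ M := by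
    intro i
    have := hM i
    have := hM v
    split_ifs <;> omega
  refine Polynomial.eq_of_infinite_eval_eq _ _ (Set.Infinite.mono (s := Set.range fun n : ℕ =>
    (((Fintype.card (Fin ℓ) + 1) * M + 1 + n : ℕ) : ℤ)) ?_
    (Set.infinite_range_of_injective fun m n h => by simpa using h))
  rintro _ ⟨n, rfl⟩
  rw [Set.mem_ofPred_eq,
    eval_charPoly_digArr hE hC0 (by omega) (fun i => ⟨by linarith [hM i], (hM i).2⟩) (by omega),
    eval_charPoly_digArr hE' hC0'' (by omega) hM' (by omega),
    card_boxPoints_ceo hcoking (fun i => (hab i).1) (fun i => (hab i).2)]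
  congr!
end
end

section
/- For all integers 1 ≤ k ≤ ℓ, the (k+1, ℓ+1)-Shi-Ish arrangement A_{ℓ+1}^{k+1} in ℝ^{ℓ+1} is affinely equivalent to the product A(T_ℓ^k, ψ_ℓ^k) × Φ_1 of the ψ_ℓ^k-digraphical arrangement of T_ℓ^k with the 1-dimensional empty arrangement. -/
open scoped Classical
open Finset

noncomputable section

namespace Paper

/-- The permutation of `{0, …, ℓ}` that matches the vertices of `T_ℓ^k` with the coordinates
`1, …, ℓ` of the Shi-Ish arrangement, and sends the last coordinate to `0`. -/
def vertexPerm (ℓ k : ℕ) (hk : 1 ≤ k) (hkl : k ≤ ℓ) : Fin (ℓ + 1) ≃ Fin (ℓ + 1) where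
  toFun i := ⟨if (i : ℕ) + k ≤ ℓ then i + k else ℓ - i, by split_ifs <;> omega⟩
  invFun q := ⟨if k ≤ (q : ℕ) then q - k else ℓ - q, by split_ifs <;> omega⟩
  left_inv i := by ext; dsimp only; split_ifs <;> omega
  right_inv q := by ext; dsimp only; split_ifs <;> omega

lemma vertexPerm_val {ℓ k : ℕ} (hk : 1 ≤ k) (hkl : k ≤ ℓ) (i : Fin (ℓ + 1)) :
    (vertexPerm ℓ k hk hkl i : ℕ) = if (i : ℕ) + k ≤ ℓ then i + k else ℓ - i := rfl

lemma vertexPerm_last {ℓ k : ℕ} (hk : 1 ≤ k) (hkl : k ≤ ℓ) :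
    vertexPerm ℓ k hk hkl (Fin.last ℓ) = 0 := by
  ext
  rw [vertexPerm_val, Fin.val_last, Fin.val_zero]
  split_ifs <;> omega

lemma exists_vertexPerm_castSucc {ℓ k : ℕ} (hk : 1 ≤ k) (hkl : k ≤ ℓ) {q : Fin (ℓ + 1)}
    (hq : q ≠ 0) : ∃ i : Fin ℓ, vertexPerm ℓ k hk hkl i.castSucc = q := by
  obtain ⟨j, rfl⟩ := (vertexPerm ℓ k hk hkl).surjective q
  induction j using Fin.lastCases with
  | last => exact absurd (vertexPerm_last hk hkl) hq
  | cast i => exact ⟨i, rfl⟩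

/-- Permute the coordinates of `ℝ^{ℓ+1}` so that the coordinate `0` becomes the last one, and
subtract it from all others. -/
def diffEquiv {ℓ : ℕ} (s : Fin (ℓ + 1) ≃ Fin (ℓ + 1)) (hs : s (Fin.last ℓ) = 0) :
    (Fin (ℓ + 1) → ℝ) ≃ₗ[ℝ] (Fin (ℓ + 1) → ℝ) where
  toFun x i := x (s i) - if i = Fin.last ℓ then 0 else x 0
  map_add' x y := by
    funext i
    simp only [Pi.add_apply]
    split_ifs <;> ring
  map_smul' c x := by
    funext i
    simp only [Pi.smul_apply, smul_eq_mul, RingHom.id_apply]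
    split_ifs <;> ring
  invFun y q := y (s.symm q) + if q = 0 then 0 else y (Fin.last ℓ)
  left_inv x := by
    funext q
    have h : s.symm q = Fin.last ℓ ↔ q = 0 := by rw [Equiv.symm_apply_eq, hs]
    by_cases hq : q = 0
    · have h0 := h.2 hq
      subst hq
      simp [h0, hs]
    · simp [h, hq, hs]
  right_inv y := by
    funext i
    have h : s i = 0 ↔ i = Fin.last ℓ := by rw [← hs, s.apply_eq_iff_eq]
    have h0 : s.symm 0 = Fin.last ℓ := by rw [Equiv.symm_apply_eq, hs]
    by_cases hi : i = Fin.last ℓ <;> simp [h, hi, h0, hs]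

section images

variable {ℓ : ℕ} {s : Fin (ℓ + 1) ≃ Fin (ℓ + 1)} (hs : s (Fin.last ℓ) = 0)

lemma diffEquiv_castSucc (x : Fin (ℓ + 1) → ℝ) (i : Fin ℓ) :
    diffEquiv s hs x i.castSucc = x (s i.castSucc) - x 0 := by
  simp [diffEquiv]

lemma diffEquiv_image {H K : Set (Fin (ℓ + 1) → ℝ)} (h : ∀ x, x ∈ H ↔ diffEquiv s hs x ∈ K) :
    (diffEquiv s hs).toAffineEquiv '' H = K := by
  ext y
  obtain ⟨x, rfl⟩ := (diffEquiv s hs).surjective y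
  rw [← h]
  exact (diffEquiv s hs).injective.mem_set_image

lemma diffEquiv_image_sub (i j : Fin ℓ) (c : ℝ) :
    (diffEquiv s hs).toAffineEquiv '' {x | x (s i.castSucc) - x (s j.castSucc) = c} =
      {y | y i.castSucc - y j.castSucc = c} :=
  diffEquiv_image hs fun x => by simp [diffEquiv_castSucc]

lemma diffEquiv_image_zero_sub (i : Fin ℓ) (c : ℝ) :
    (diffEquiv s hs).toAffineEquiv '' {x | x 0 - x (s i.castSucc) = c} =
      {y | y i.castSucc = -c} :=
  diffEquiv_image hs fun x => by
    simp only [Set.mem_ofPred_eq, diffEquiv_castSucc]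
    constructor <;> intro h <;> linarith

end images

lemma mem_ShiIsh {ℓ k : ℕ} {H : Set (Fin ℓ → ℝ)} :
    H ∈ ShiIsh ℓ k ↔
      (∃ p q : Fin ℓ, p < q ∧ {x : Fin ℓ → ℝ | x p - x q = 0} = H) ∨
      (∃ p q : Fin ℓ, p < q ∧ k ≤ (p : ℕ) + 1 ∧ {x : Fin ℓ → ℝ | x p - x q = 1} = H) ∨
      (∃ p q : Fin ℓ, (p : ℕ) = 0 ∧ ∃ c : ℕ, 1 ≤ c ∧ c ≤ q ∧ c < k ∧
        {x : Fin ℓ → ℝ | x p - x q = (c : ℝ)} = H) := by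
  simp only [ShiIsh, mem_union, mem_image, mem_filter, mem_univ, true_and, mem_biUnion,
    Finset.mem_Icc, Prod.exists, and_assoc, or_assoc, Finset.bind_def, Finset.pure_def,
    mem_sup, mem_singleton]
  refine or_congr .rfl (or_congr .rfl (exists₂_congr fun p q => and_congr_right fun _ => ?_))
  constructor
  · rintro ⟨_, ⟨c, h₁, h₂, h₃, rfl⟩, h⟩
    exact ⟨c, h₁, h₂, h₃, h⟩
  · rintro ⟨c, h₁, h₂, h₃, h⟩
    exact ⟨_, ⟨c, h₁, h₂, h₃, rfl⟩, h⟩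

lemma mem_digArr {ι : Type} [Fintype ι] {E : Finset (ι × ι)} {a b : ι → ℤ} {H : Set (ι → ℝ)} :
    H ∈ digArr E a b ↔
      (∃ i j : ι, i ≠ j ∧ {x : ι → ℝ | x i - x j = 0} = H) ∨
      (∃ i j : ι, (i, j) ∈ E ∧ {x : ι → ℝ | x i - x j = 1} = H) ∨
      (∃ i : ι, ∃ c : ℤ, a i ≤ c ∧ c ≤ b i ∧ {x : ι → ℝ | x i = (c : ℝ)} = H) := by
  simp only [digArr, mem_union, mem_image, mem_filter, mem_univ, true_and, mem_biUnion,
    Finset.mem_Icc, Prod.exists, and_assoc, or_assoc, Finset.bind_def, Finset.pure_def,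
    mem_sup, mem_singleton]
  refine or_congr .rfl (or_congr .rfl (exists_congr fun i => ?_))
  constructor
  · rintro ⟨_, ⟨c, h₁, h₂, rfl⟩, h⟩
    exact ⟨c, h₁, h₂, h⟩
  · rintro ⟨c, h₁, h₂, h⟩
    exact ⟨_, ⟨c, h₁, h₂, rfl⟩, h⟩

end Paper

open Paper in
/-- for `1 ≤ k ≤ ℓ`, the (k+1, ℓ+1)-Shi-Ish arrangement is affinely
equivalent to `A(T_ℓ^k, ψ_ℓ^k) × Φ_1`. -/
theorem shi_ish_affine_equiv (ℓ k : ℕ) (hk : 1 ≤ k) (hkl : k ≤ ℓ) :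
    ∃ φ : (Fin (ℓ + 1) → ℝ) ≃ᵃ[ℝ] (Fin (ℓ + 1) → ℝ),
      (ShiIsh (ℓ + 1) (k + 1)).image (fun H => φ '' H)
        = (digArr (Tlk ℓ k) (psiLk ℓ k) (fun _ => 0)).image
            (fun H => {x : Fin (ℓ + 1) → ℝ | (fun i : Fin ℓ => x i.castSucc) ∈ H}) := by
  have hs := vertexPerm_last hk hkl
  set s := vertexPerm ℓ k hk hkl
  have hval : ∀ i : Fin ℓ, (s i.castSucc : ℕ) = if (i : ℕ) + k ≤ ℓ then i + k else ℓ - i :=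
    fun i => vertexPerm_val hk hkl i.castSucc
  have hsurj : ∀ q : Fin (ℓ + 1), q ≠ 0 → ∃ i : Fin ℓ, s i.castSucc = q :=
    fun q hq => exists_vertexPerm_castSucc hk hkl hq
  have hinj : ∀ i j : Fin ℓ, s i.castSucc = s j.castSucc → i = j := fun i j h =>
    Fin.castSucc_injective _ (s.injective h)
  refine ⟨(diffEquiv s hs).toAffineEquiv, ?_⟩
  ext K
  simp only [mem_image, mem_ShiIsh, mem_digArr]
  constructor
  · rintro ⟨H, ⟨p, q, hpq, rfl⟩ | ⟨p, q, hpq, hp, rfl⟩ | ⟨p, q, hp, c, hc1, hcq, hck, rfl⟩, rfl⟩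
    · obtain ⟨j, rfl⟩ := hsurj q (Fin.ne_zero_of_lt hpq)
      by_cases hp : p = 0
      · subst hp
        refine ⟨_, Or.inr (Or.inr ⟨j, 0, ?_, le_rfl, rfl⟩), ?_⟩
        · simp only [psiLk]
          have := j.isLt
          omega
        · rw [diffEquiv_image_zero_sub]
          simp
      · obtain ⟨i, rfl⟩ := hsurj p hp
        refine ⟨_, Or.inl ⟨i, j, ?_, rfl⟩, ?_⟩
        · rintro rfl
          exact lt_irrefl _ hpq
        · rw [diffEquiv_image_sub]
          rfl
    · obtain ⟨j, rfl⟩ := hsurj q (Fin.ne_zero_of_lt hpq)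
      obtain ⟨i, rfl⟩ := hsurj p (by rintro rfl; simp at hp; omega)
      refine ⟨_, Or.inr (Or.inl ⟨i, j, ?_, rfl⟩), ?_⟩
      · rw [Fin.lt_def, hval, hval] at hpq
        rw [hval] at hp
        simp only [Tlk, mem_filter, mem_univ, true_and, Fin.lt_def]
        split_ifs at hpq hp <;> omega
      · rw [diffEquiv_image_sub]
        rfl
    · obtain rfl : p = 0 := Fin.ext hp
      obtain ⟨j, rfl⟩ := hsurj q (by rintro rfl; simp at hcq; omega)
      refine ⟨_, Or.inr (Or.inr ⟨j, -c, ?_, by omega, rfl⟩), ?_⟩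
      · rw [hval] at hcq
        simp only [psiLk]
        split_ifs at hcq <;> omega
      · rw [diffEquiv_image_zero_sub]
        simp
  · rintro ⟨H, ⟨i, j, hij, rfl⟩ | ⟨i, j, hij, rfl⟩ | ⟨j, c, hc, hc0, rfl⟩, rfl⟩
    · rcases lt_or_gt_of_ne (fun h => hij (hinj i j h)) with h | h
      · exact ⟨_, Or.inl ⟨_, _, h, rfl⟩, diffEquiv_image_sub hs i j 0⟩
      · refine ⟨_, Or.inl ⟨_, _, h, rfl⟩, (diffEquiv_image_sub hs j i 0).trans ?_⟩
        ext x
        simp only [Set.mem_ofPred_eq, sub_eq_zero]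
        exact eq_comm
    · simp only [Tlk, mem_filter, mem_univ, true_and, Fin.lt_def] at hij
      refine ⟨_, Or.inr (Or.inl ⟨s i.castSucc, s j.castSucc, ?_, ?_, rfl⟩),
        diffEquiv_image_sub hs i j 1⟩
      · rw [Fin.lt_def, hval, hval]
        split_ifs <;> omega
      · rw [hval]
        split_ifs <;> omega
    · have hj := j.isLt
      have hpos : 0 < (s j.castSucc : ℕ) := by
        rw [hval]
        split_ifs <;> omega
      simp only [psiLk] at hc
      obtain ⟨n, rfl⟩ := Int.exists_eq_neg_ofNat hc0
      rcases Nat.eq_zero_or_pos n with rfl | hn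
      · refine ⟨_, Or.inl ⟨0, s j.castSucc, hpos, rfl⟩, ?_⟩
        rw [diffEquiv_image_zero_sub]
        simp
      · refine ⟨_, Or.inr (Or.inr ⟨0, s j.castSucc, rfl, n, hn, ?_, ?_, rfl⟩), ?_⟩
        · rw [hval]
          split_ifs <;> omega
        · omega
        · rw [diffEquiv_image_zero_sub]
          simp
end
end

section
/- Let B be a central arrangement in ℝ^m and let X ∈ L(B) be a modular coatom of B. Then t·χ_B(t) = (t − |B ∖ B_X|)·χ_{B_X}(t), where |B ∖ B_X| is the number of hyperplanes of B not containing X. -/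
open scoped Classical
open Finset

noncomputable section

namespace Paper

open scoped Pointwise

section Poset

variable {ι : Type}

lemma mem_L {A : Finset (Set (ι → ℝ))} {Y : Set (ι → ℝ)} :
    Y ∈ L A ↔ (∃ S ⊆ A, inter S = Y) ∧ Y.Nonempty := by
  simp [L]

lemma univ_mem_L (A : Finset (Set (ι → ℝ))) : Set.univ ∈ L A :=
  mem_L.2 ⟨⟨∅, by simp, by simp [inter]⟩, Set.univ_nonempty⟩

lemma mob_univ (A : Finset (Set (ι → ℝ))) : mob A Set.univ = 1 := by
  rw [mob, if_pos rfl]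

lemma mob_of_ne_univ (A : Finset (Set (ι → ℝ))) {X : Set (ι → ℝ)} (h : X ≠ Set.univ) :
    mob A X = - ∑ Y ∈ above A X, mob A Y := by
  rw [mob, if_neg h, Finset.sum_attach (above A X) (mob A)]

/-- The elements of `L A` containing `W ∈ L A` are `W` and those strictly above it. -/
lemma filter_subset_eq_insert {A : Finset (Set (ι → ℝ))} {W : Set (ι → ℝ)} (hW : W ∈ L A) :
    (L A).filter (W ⊆ ·) = insert W (above A W) := by
  ext Y
  simp only [above, Finset.mem_filter, Finset.mem_insert]
  constructor
  · rintro ⟨hY, hs⟩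
    rcases hs.eq_or_ssubset with h | h
    · exact Or.inl h.symm
    · exact Or.inr ⟨hY, h⟩
  · rintro (rfl | ⟨hY, h⟩)
    · exact ⟨hW, subset_rfl⟩
    · exact ⟨hY, h.subset⟩

lemma notMem_above (A : Finset (Set (ι → ℝ))) (W : Set (ι → ℝ)) : W ∉ above A W := by
  simp [above]

lemma sum_mob_eq_zero {A : Finset (Set (ι → ℝ))} {W : Set (ι → ℝ)} (hW : W ∈ L A)
    (h : W ≠ Set.univ) : ∑ Y ∈ (L A).filter (W ⊆ ·), mob A Y = 0 := by
  rw [filter_subset_eq_insert hW, Finset.sum_insert (notMem_above A W), mob_of_ne_univ A h]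
  simp

/-- Induction along the intersection poset, from the whole space downwards. -/
lemma above_induction {A : Finset (Set (ι → ℝ))} {P : Set (ι → ℝ) → Prop}
    (step : ∀ W, (∀ W' ∈ above A W, P W') → P W) (W : Set (ι → ℝ)) : P W := by
  induction hn : (above A W).card using Nat.strong_induction_on generalizing W with
  | _ n ih =>
    subst hn
    exact step W fun W' hW' => ih _ (above_lt hW') W' rfl

lemma L_loc (A : Finset (Set (ι → ℝ))) (X : Set (ι → ℝ)) :
    L (loc A X) = (L A).filter (X ⊆ ·) := by
  ext Y
  simp only [Finset.mem_filter, mem_L]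
  constructor
  · rintro ⟨⟨S, hS, rfl⟩, hne⟩
    refine ⟨⟨⟨S, hS.trans (Finset.filter_subset _ _), rfl⟩, hne⟩, ?_⟩
    exact Set.subset_iInter₂ fun H hH => (Finset.mem_filter.1 (hS hH)).2
  · rintro ⟨⟨⟨S, hS, rfl⟩, hne⟩, hX⟩
    exact ⟨⟨S, fun H hH => Finset.mem_filter.2 ⟨hS hH, hX.trans (Set.iInter₂_subset H hH)⟩,
      rfl⟩, hne⟩

lemma above_loc (A : Finset (Set (ι → ℝ))) {X Z : Set (ι → ℝ)} (h : X ⊆ Z) :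
    above (loc A X) Z = above A Z := by
  ext Y
  simp only [above, L_loc, Finset.mem_filter]
  exact ⟨fun hY => ⟨hY.1.1, hY.2⟩, fun hY => ⟨⟨hY.1, h.trans hY.2.subset⟩, hY.2⟩⟩

lemma mob_loc (A : Finset (Set (ι → ℝ))) {X : Set (ι → ℝ)} (Z : Set (ι → ℝ)) (h : X ⊆ Z) :
    mob (loc A X) Z = mob A Z := by
  induction Z using above_induction (A := A) with
  | step Z ih =>
    by_cases hZ : Z = Set.univ
    · rw [hZ, mob_univ, mob_univ]
    · rw [mob_of_ne_univ _ hZ, mob_of_ne_univ _ hZ, above_loc A h]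
      exact congrArg _ (Finset.sum_congr rfl fun Y hY =>
        ih Y hY (h.trans (Finset.mem_filter.1 hY).2.subset))

/-- Weisner's theorem. -/
lemma sum_mob_inter_eq_zero {A : Finset (Set (ι → ℝ))}
    (hinter : ∀ Y ∈ L A, ∀ Z ∈ L A, Y ∩ Z ∈ L A) {Z : Set (ι → ℝ)} (hZ : Z ∈ L A)
    (hne : Z ≠ Set.univ) (W : Set (ι → ℝ)) (hW : W ∈ L A) (hWZ : W ⊆ Z) :
    ∑ Y ∈ (L A).filter (fun Y => Y ∩ Z = W), mob A Y = 0 := by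
  induction W using above_induction (A := A) with
  | step W ih =>
    have hWne : W ≠ Set.univ := fun h => hne (Set.univ_subset_iff.1 (h ▸ hWZ))
    have key := sum_mob_eq_zero hW hWne
    have hmaps : ∀ Y ∈ (L A).filter (W ⊆ ·), Y ∩ Z ∈ (L A).filter (W ⊆ ·) := by
      intro Y hY
      rw [Finset.mem_filter] at hY ⊢
      exact ⟨hinter _ hY.1 _ hZ, Set.subset_inter hY.2 hWZ⟩
    have hfib : ∀ W' ∈ (L A).filter (W ⊆ ·),
        ∑ Y ∈ ((L A).filter (W ⊆ ·)).filter (fun Y => Y ∩ Z = W'), mob A Y =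
          ∑ Y ∈ (L A).filter (fun Y => Y ∩ Z = W'), mob A Y := by
      intro W' hW'
      refine Finset.sum_congr ?_ fun _ _ => rfl
      ext Y
      simp only [Finset.mem_filter]
      refine ⟨fun h => ⟨h.1.1, h.2⟩, fun h => ⟨⟨h.1, ?_⟩, h.2⟩⟩
      exact ((Finset.mem_filter.1 hW').2.trans h.2.symm.subset).trans Set.inter_subset_left
    rw [← Finset.sum_fiberwise_of_maps_to hmaps, Finset.sum_congr rfl hfib,
      filter_subset_eq_insert hW, Finset.sum_insert (notMem_above A W)] at key
    rw [← key, left_eq_add]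
    refine Finset.sum_eq_zero fun W' hW' => ?_
    by_cases hs : W' ⊆ Z
    · exact ih W' hW' (Finset.mem_filter.1 hW').1 hs
    · refine Finset.sum_eq_zero fun Y hY => absurd ?_ hs
      exact (Finset.mem_filter.1 hY).2 ▸ Set.inter_subset_right

end Poset

section Linear

variable {m : ℕ} {B : Finset (Set (Fin m → ℝ))}

lemma dim_coe (p : Submodule ℝ (Fin m → ℝ)) :
    dim (p : Set (Fin m → ℝ)) = Module.finrank ℝ p := by
  have h : affineSpan ℝ (p : Set (Fin m → ℝ)) = p.toAffineSubspace :=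
    AffineSubspace.affineSpan_coe p.toAffineSubspace
  rw [dim, h, Submodule.toAffineSubspace_direction]

lemma exists_isCoatom_coe_eq_linHyp {c : Fin m → ℝ} (hc : c ≠ 0) :
    ∃ p : Submodule ℝ (Fin m → ℝ), IsCoatom p ∧ linHyp c = p := by
  refine ⟨LinearMap.ker (dotProductBilin ℝ ℝ c), ?_, ?_⟩
  · refine LinearMap.isCoatom_ker_of_surjective (LinearMap.surjective fun h => hc ?_)
    exact dotProduct_self_eq_zero.1 (LinearMap.congr_fun h c)
  · ext x
    simp [linHyp, dotProduct]

/-- A flat other than the whole space lies in some hyperplane. -/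
lemma exists_hyperplane_superset {Y : Set (Fin m → ℝ)} (hY : Y ∈ L B) (h : Y ≠ Set.univ) :
    ∃ H ∈ B, Y ⊆ H := by
  obtain ⟨⟨S, hS, rfl⟩, -⟩ := mem_L.1 hY
  rcases S.eq_empty_or_nonempty with rfl | ⟨H, hH⟩
  · simp [inter] at h
  · exact ⟨H, hS hH, Set.iInter₂_subset H hH⟩

variable (hB : ∀ H ∈ B, ∃ p : Submodule ℝ (Fin m → ℝ), IsCoatom p ∧ H = p)
include hB

lemma exists_submodule {Y : Set (Fin m → ℝ)} (hY : Y ∈ L B) :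
    ∃ p : Submodule ℝ (Fin m → ℝ), Y = p := by
  obtain ⟨⟨S, hS, rfl⟩, -⟩ := mem_L.1 hY
  choose! p hp using hB
  refine ⟨⨅ H ∈ S, p H, ?_⟩
  simp only [inter, Submodule.coe_iInf]
  exact Set.iInter₂_congr fun H hH => (hp H (hS hH)).2

lemma inter_mem_L {Y Z : Set (Fin m → ℝ)} (hY : Y ∈ L B) (hZ : Z ∈ L B) : Y ∩ Z ∈ L B := by
  obtain ⟨p, hp⟩ := exists_submodule hB hY
  obtain ⟨q, hq⟩ := exists_submodule hB hZ
  obtain ⟨⟨S, hS, hSY⟩, -⟩ := mem_L.1 hY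
  obtain ⟨⟨T, hT, hTZ⟩, -⟩ := mem_L.1 hZ
  refine mem_L.2 ⟨⟨S ∪ T, Finset.union_subset hS hT, ?_⟩, 0, ?_, ?_⟩
  · subst hSY hTZ
    simp only [inter, Finset.mem_union, Set.iInter_or, Set.iInter_inter_distrib]
  · rw [hp]; exact p.zero_mem
  · rw [hq]; exact q.zero_mem

lemma hyperplane_mem_L {H : Set (Fin m → ℝ)} (hH : H ∈ B) : H ∈ L B := by
  obtain ⟨p, -, hp⟩ := hB H hH
  refine mem_L.2 ⟨⟨{H}, by simpa using hH, by simp [inter]⟩, 0, ?_⟩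
  rw [hp]; exact p.zero_mem

lemma mob_hyperplane {H : Set (Fin m → ℝ)} (hH : H ∈ B) : mob B H = -1 := by
  obtain ⟨p, hpc, rfl⟩ := hB H hH
  have hne : (p : Set (Fin m → ℝ)) ≠ Set.univ := fun h =>
    hpc.1 (SetLike.coe_injective (by simpa using h))
  have habove : above B p = {Set.univ} := by
    ext Y
    simp only [above, Finset.mem_filter, Finset.mem_singleton]
    constructor
    · rintro ⟨hY, hlt⟩
      obtain ⟨q, rfl⟩ := exists_submodule hB hY
      rw [hpc.2 q (SetLike.coe_ssubset_coe.1 hlt), Submodule.top_coe]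
    · rintro rfl
      exact ⟨univ_mem_L B, (Set.subset_univ _).ssubset_of_ne hne⟩
  rw [mob_of_ne_univ B hne, habove, Finset.sum_singleton, mob_univ]

variable {X : Set (Fin m → ℝ)}

/-- Adding a modular coatom to a flat not containing it raises the dimension by one. -/
lemma dim_add_of_isModularCoatom (hX : IsModularCoatom B X) {Y : Set (Fin m → ℝ)} (hY : Y ∈ L B)
    (hXY : ¬ X ⊆ Y) : dim (X + Y) = dim Y + 1 := by
  have hI := inter_mem_L hB hX.1.1 hY
  have hr : Fintype.card (Fin m) - dim (X ∩ Y) ≤ rank B :=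
    Finset.le_sup (f := fun X => Fintype.card (Fin m) - dim X) hI
  have hd := hX.2
  obtain ⟨p, rfl⟩ := exists_submodule hB hX.1.1
  obtain ⟨q, rfl⟩ := exists_submodule hB hY
  have hlt : p ⊓ q < p := inf_lt_left.2 fun h => hXY h
  have h1 := Submodule.finrank_lt_finrank_of_lt hlt
  have h2 := Submodule.finrank_sup_add_finrank_inf_eq p q
  have h3 := Submodule.finrank_le p
  rw [Module.finrank_fin_fun] at h3
  rw [← Submodule.coe_inf, dim_coe, Fintype.card_fin] at hr
  rw [dim_coe, Fintype.card_fin] at hd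
  rw [← Submodule.coe_sup, dim_coe, dim_coe]
  omega

/-- The flats not containing a modular coatom `X` and spanning the whole space together with `X`
are the hyperplanes not containing `X`. -/
lemma filter_add_eq_univ (hX : IsModularCoatom B X) :
    (L B).filter (fun Y => ¬ X ⊆ Y ∧ X + Y = Set.univ) = B \ loc B X := by
  ext Y
  simp only [loc, Finset.mem_filter, Finset.mem_sdiff, not_and]
  constructor
  · rintro ⟨hY, hXY, hadd⟩
    have hdim := dim_add_of_isModularCoatom hB hX hY hXY
    obtain ⟨H, hH, hYH⟩ := exists_hyperplane_superset hY
      fun h => hXY (h ▸ Set.subset_univ X)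
    obtain ⟨p, hpc, rfl⟩ := hB H hH
    obtain ⟨q, rfl⟩ := exists_submodule hB hY
    have h1 := Submodule.finrank_lt hpc.1
    rw [hadd, ← Submodule.top_coe (R := ℝ), dim_coe, dim_coe, finrank_top] at hdim
    rw [← Submodule.eq_of_le_of_finrank_le (SetLike.coe_subset_coe.1 hYH) (by omega)] at hH
    exact ⟨hH, fun _ => hXY⟩
  · rintro ⟨hY, h⟩
    refine ⟨hyperplane_mem_L hB hY, h hY, ?_⟩
    have hXY := h hY
    obtain ⟨p, hp⟩ := exists_submodule hB hX.1.1
    obtain ⟨q, hq, rfl⟩ := hB Y hY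
    subst hp
    rw [← Submodule.coe_sup, hq.2 (p ⊔ q) (right_lt_sup.2 fun h => hXY h), Submodule.top_coe]

/-- For flats `X ⊆ Z`, intersecting with `Z` relates the flats `Y` with `Z ⊆ X + Y` and the flats
`W` with `X + W = Z`. -/
lemma inter_not_subset_and_add_eq_iff {Y Z : Set (Fin m → ℝ)} (hX : X ∈ L B) (hY : Y ∈ L B)
    (hZ : Z ∈ L B) (hXZ : X ⊆ Z) :
    (¬ X ⊆ Y ∩ Z ∧ X + Y ∩ Z = Z) ↔ (¬ X ⊆ Y ∧ Z ⊆ X + Y) := by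
  obtain ⟨p, rfl⟩ := exists_submodule hB hX
  obtain ⟨q, rfl⟩ := exists_submodule hB hY
  obtain ⟨z, rfl⟩ := exists_submodule hB hZ
  rw [← Submodule.coe_inf, ← Submodule.coe_sup, ← Submodule.coe_sup, SetLike.coe_subset_coe,
    SetLike.coe_subset_coe, SetLike.coe_subset_coe, SetLike.coe_set_eq,
    ← sup_inf_assoc_of_le q (SetLike.coe_subset_coe.1 hXZ), inf_eq_right, le_inf_iff]
  exact and_congr_left' (not_congr (and_iff_left hXZ))

lemma sum_mob_subset_add_eq_zero (hX : X ∈ L B) {Z : Set (Fin m → ℝ)} (hZ : Z ∈ L B)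
    (hXZ : X ⊆ Z) (hne : Z ≠ Set.univ) :
    ∑ Y ∈ (L B).filter (fun Y => ¬ X ⊆ Y ∧ Z ⊆ X + Y), mob B Y = 0 := by
  have hmaps : ∀ Y ∈ (L B).filter (fun Y => ¬ X ⊆ Y ∧ Z ⊆ X + Y),
      Y ∩ Z ∈ (L B).filter (fun W => W ⊆ Z ∧ ¬ X ⊆ W ∧ X + W = Z) := by
    intro Y hY
    rw [Finset.mem_filter] at hY ⊢
    exact ⟨inter_mem_L hB hY.1 hZ, Set.inter_subset_right,
      (inter_not_subset_and_add_eq_iff hB hX hY.1 hZ hXZ).2 hY.2⟩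
  rw [← Finset.sum_fiberwise_of_maps_to hmaps]
  refine Finset.sum_eq_zero fun W hW => ?_
  rw [Finset.mem_filter] at hW
  rw [← sum_mob_inter_eq_zero (fun _ h _ h' => inter_mem_L hB h h') hZ hne W hW.1 hW.2.1,
    Finset.filter_filter]
  refine Finset.sum_congr (Finset.filter_congr fun Y hY => ?_) fun _ _ => rfl
  refine and_iff_right_of_imp fun h => ?_
  exact (inter_not_subset_and_add_eq_iff hB hX hY hZ hXZ).1 (h ▸ hW.2.2)

lemma sum_mob_add_eq (hX : IsModularCoatom B X) (Z : Set (Fin m → ℝ)) (hZ : Z ∈ L B)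
    (hXZ : X ⊆ Z) :
    ∑ Y ∈ (L B).filter (fun Y => ¬ X ⊆ Y ∧ X + Y = Z), mob B Y =
      -((B \ loc B X).card * mob B Z) := by
  induction Z using above_induction (A := B) with
  | step Z ih =>
    by_cases hne : Z = Set.univ
    · subst hne
      rw [filter_add_eq_univ hB hX, mob_univ, Finset.sum_congr rfl fun H hH =>
        mob_hyperplane hB (Finset.mem_sdiff.1 hH).1]
      simp
    · have key := sum_mob_subset_add_eq_zero hB hX.1.1 hZ hXZ hne
      have hmaps : ∀ Y ∈ (L B).filter (fun Y => ¬ X ⊆ Y ∧ Z ⊆ X + Y),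
          X + Y ∈ (L B).filter (Z ⊆ ·) := by
        intro Y hY
        rw [Finset.mem_filter] at hY ⊢
        exact ⟨hX.1.2 Y hY.1, hY.2.2⟩
      have hfib : ∀ Z' ∈ (L B).filter (Z ⊆ ·),
          ∑ Y ∈ ((L B).filter (fun Y => ¬ X ⊆ Y ∧ Z ⊆ X + Y)).filter (fun Y => X + Y = Z'),
            mob B Y = ∑ Y ∈ (L B).filter (fun Y => ¬ X ⊆ Y ∧ X + Y = Z'), mob B Y := by
        intro Z' hZ'
        rw [Finset.filter_filter]
        refine Finset.sum_congr (Finset.filter_congr fun Y _ => ?_) fun _ _ => rfl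
        constructor
        · exact fun h => ⟨h.1.1, h.2⟩
        · exact fun h => ⟨⟨h.1, h.2 ▸ (Finset.mem_filter.1 hZ').2⟩, h.2⟩
      rw [← Finset.sum_fiberwise_of_maps_to hmaps, Finset.sum_congr rfl hfib,
        filter_subset_eq_insert hZ, Finset.sum_insert (notMem_above B Z),
        Finset.sum_congr rfl fun Z' hZ' => ih Z' hZ' (Finset.mem_filter.1 hZ').1
          (hXZ.trans (Finset.mem_filter.1 hZ').2.subset),
        Finset.sum_neg_distrib, ← Finset.mul_sum] at key
      rw [mob_of_ne_univ B hne]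
      linarith

/-- The flats not containing the modular coatom `X` contribute `-|B \ B_X| χ_{B_X}(t)` to
`t χ_B(t)`. -/
lemma X_mul_sum_not_subset (hX : IsModularCoatom B X) :
    Polynomial.X * ∑ Y ∈ (L B).filter (fun Y => ¬ X ⊆ Y),
        Polynomial.C (mob B Y) * Polynomial.X ^ dim Y =
      -(Polynomial.C ((B \ loc B X).card : ℤ) * charPoly (loc B X)) := by
  have hmaps : ∀ Y ∈ (L B).filter (fun Y => ¬ X ⊆ Y), X + Y ∈ (L B).filter (X ⊆ ·) := by
    intro Y hY
    rw [Finset.mem_filter] at hY ⊢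
    refine ⟨hX.1.2 Y hY.1, ?_⟩
    obtain ⟨q, hq⟩ := exists_submodule hB hY.1
    exact Set.subset_add_left X (by rw [hq]; exact q.zero_mem)
  rw [Finset.mul_sum, ← Finset.sum_fiberwise_of_maps_to hmaps, charPoly, L_loc, Finset.mul_sum,
    ← Finset.sum_neg_distrib]
  refine Finset.sum_congr rfl fun Z hZ => ?_
  rw [Finset.mem_filter] at hZ
  rw [mob_loc B Z hZ.2, ← mul_assoc, ← Polynomial.C_mul, ← neg_mul, ← Polynomial.C_neg,
    ← sum_mob_add_eq hB hX Z hZ.1 hZ.2, map_sum, Finset.sum_mul, Finset.filter_filter]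
  refine Finset.sum_congr rfl fun Y hY => ?_
  obtain ⟨hYL, hXY, rfl⟩ := Finset.mem_filter.1 hY
  rw [dim_add_of_isModularCoatom hB hX hYL hXY]
  ring

end Linear

end Paper

open Paper in
/-- if `X` is a modular coatom of a central arrangement `B`, then
`t·χ_B(t) = (t - |B ∖ B_X|)·χ_{B_X}(t)`. -/
theorem modular_coatom_charPoly (m : ℕ) (B : Finset (Set (Fin m → ℝ)))
    (hcentral : ∀ H ∈ B, ∃ c : Fin m → ℝ, c ≠ 0 ∧ H = linHyp c)
    (X : Set (Fin m → ℝ)) (hX : IsModularCoatom B X) :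
    Polynomial.X * charPoly B
      = (Polynomial.X - Polynomial.C (((B \ loc B X).card : ℤ))) * charPoly (loc B X) := by
  have hB : ∀ H ∈ B, ∃ p : Submodule ℝ (Fin m → ℝ), IsCoatom p ∧ H = p := by
    intro H hH
    obtain ⟨c, hc, rfl⟩ := hcentral H hH
    exact exists_isCoatom_coe_eq_linHyp hc
  have hloc : ∑ Y ∈ (L B).filter (X ⊆ ·), Polynomial.C (mob B Y) * Polynomial.X ^ dim Y =
      charPoly (loc B X) := by
    rw [charPoly, L_loc]
    exact Finset.sum_congr rfl fun Z hZ => by rw [mob_loc B Z (Finset.mem_filter.1 hZ).2]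
  rw [charPoly, ← Finset.sum_filter_add_sum_filter_not (L B) (X ⊆ ·), mul_add, hloc,
    X_mul_sum_not_subset hB hX, sub_mul, sub_eq_add_neg]
end
end
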